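/- arXiv:2306.07452 — 3 statements merged into one kernel-verified Lean document; each statement's English description precedes it below -/
import Mathlib

section
/- Let Ω ⊂ ℂⁿ be a bounded domain with smooth boundary which is Levi pseudoconvex. Then there is an open neighborhood U of ∂Ω such that the function z ↦ -log(d_{∂Ω}(z)) is plurisubharmonic on Ω ∩ U. -/
open MeasureTheory Metric Filter Topology Set
open scoped ENNReal

noncomputable section

/-- The positive part of an extended real number, as an extended nonnegative real. -/
def erealToENNReal (x : EReal) : ℝ≥0∞ := if x = ⊤ then ⊤ else ENNReal.ofReal x.toReal

variable {E : Type*} [NormedAddCommGroup E] [MeasureSpace E]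

/-- The mean value `M_u(x,r)` of an extended-real-valued function `u` over the ball `B(x,r)`,
computed as the difference of the integrals of the positive and negative parts. -/
def erealBallAvg (u : E → EReal) (x : E) (r : ℝ) : EReal :=
  (((∫⁻ y in ball x r, erealToENNReal (u y)) / volume (ball x r) : ℝ≥0∞) : EReal)
    - (((∫⁻ y in ball x r, erealToENNReal (-(u y))) / volume (ball x r) : ℝ≥0∞) : EReal)

/-- The sub-mean value property on a set `s`: at each point of `s` the value of `u` is at most
its average over every sufficiently small ball centered at the point and contained in `s`. -/
def SubmeanOn (u : E → EReal) (s : Set E) : Prop :=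
  ∀ x ∈ s, ∃ R > 0, ∀ r : ℝ, 0 < r → r < R → closedBall x r ⊆ s →
    u x ≤ erealBallAvg u x r

/-- `u : E → [-∞,∞)` is subharmonic on `s` if it is upper semicontinuous on `s`, not
identically `-∞` on `s`, takes values in `[-∞,∞)`, and satisfies the sub-mean value
inequality on `s`. -/
def IsSubharmonicOn (u : E → EReal) (s : Set E) : Prop :=
  UpperSemicontinuousOn u s ∧ (¬ ∀ x ∈ s, u x = ⊥) ∧ (∀ x ∈ s, u x < ⊤) ∧ SubmeanOn u s

/-- `u` is plurisubharmonic on `s ⊆ ℂⁿ` if it is upper semicontinuous on `s`, not identically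
`-∞` on `s`, takes values in `[-∞,∞)`, and its restriction to every complex line satisfies the
sub-mean value inequality (i.e. is subharmonic where defined). -/
def IsPlurisubharmonicOn {n : ℕ} (u : EuclideanSpace ℂ (Fin n) → EReal)
    (s : Set (EuclideanSpace ℂ (Fin n))) : Prop :=
  UpperSemicontinuousOn u s ∧ (¬ ∀ z ∈ s, u z = ⊥) ∧ (∀ z ∈ s, u z < ⊤) ∧
    ∀ a b : EuclideanSpace ℂ (Fin n),
      SubmeanOn (fun w : ℂ => u (a + w • b)) {w : ℂ | a + w • b ∈ s}

/-- `ρ` is a `C^k` local defining function for the domain `Ω` near the boundary point `p`,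
defined on the open neighborhood `V`: it is `C^k` on `V`, has nonvanishing gradient on the
boundary, is negative exactly on `Ω ∩ V` and vanishes exactly on `∂Ω ∩ V`. -/
def IsLocalDefiningFunction {F : Type*} [NormedAddCommGroup F] [NormedSpace ℝ F]
    (Ω : Set F) (k : ℕ∞) (p : F) (V : Set F) (ρ : F → ℝ) : Prop :=
  IsOpen V ∧ p ∈ V ∧ ContDiffOn ℝ k ρ V ∧
    (∀ q ∈ V ∩ frontier Ω, fderiv ℝ ρ q ≠ 0) ∧
    Ω ∩ V = {q | q ∈ V ∧ ρ q < 0} ∧ frontier Ω ∩ V = {q | q ∈ V ∧ ρ q = 0}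

/-- `Ω` has `C^k`-smooth boundary: every boundary point admits a `C^k` local defining
function. -/
def HasCkBoundary {F : Type*} [NormedAddCommGroup F] [NormedSpace ℝ F]
    (Ω : Set F) (k : ℕ∞) : Prop :=
  ∀ p ∈ frontier Ω, ∃ V ρ, IsLocalDefiningFunction Ω k p V ρ

/-- `Ω ⊆ ℂⁿ` is Levi pseudoconvex: for every boundary point `p`, every local `C²` defining
function `ρ` near `p` and every complex tangent vector `X` at `p` (i.e. `X` and `i•X` are both
annihilated by `dρ(p)`), the Levi form of `ρ` at `p` in the direction `X` is nonnegative.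
The Levi form is expressed through the real Hessian `H` of `ρ` by the standard identity
`4·L(ρ)(X,X) = H(X,X) + H(iX,iX)`. -/
def LeviPseudoconvex {n : ℕ} (Ω : Set (EuclideanSpace ℂ (Fin n))) : Prop :=
  ∀ p ∈ frontier Ω, ∀ V ρ, IsLocalDefiningFunction Ω 2 p V ρ →
    ∀ X : EuclideanSpace ℂ (Fin n),
      fderiv ℝ ρ p X = 0 → fderiv ℝ ρ p (Complex.I • X) = 0 →
      0 ≤ fderiv ℝ (fun q => fderiv ℝ ρ q X) p X
          + fderiv ℝ (fun q => fderiv ℝ ρ q (Complex.I • X)) p (Complex.I • X)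

/-- On a circle, a continuous real function is a uniform limit of real parts of entire functions. -/
theorem exists_entire_re_near_on_sphere {u : ℂ → ℝ} {x : ℂ} {r : ℝ} (hr : 0 < r)
    (hu : ContinuousOn u (sphere x r)) {η : ℝ} (hη : 0 < η) :
    ∃ f : ℂ → ℂ, Differentiable ℂ f ∧ ∀ τ ∈ sphere x r, |u τ - (f τ).re| < η := by
  have : Fact (0 < 2 * Real.pi) := ⟨Real.two_pi_pos⟩
  have hmem : ∀ θ : AddCircle (2 * Real.pi), x + r * fourier 1 θ ∈ sphere x r := by
    intro θ
    simp [abs_of_pos hr, Circle.norm_coe]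
  let g : C(AddCircle (2 * Real.pi), ℂ) :=
    ⟨fun θ => (u (x + r * fourier 1 θ) : ℂ), Complex.continuous_ofReal.comp
      (hu.comp_continuous (by fun_prop) hmem)⟩
  have hg : g ∈ (Submodule.span ℂ (range <| @fourier (2 * Real.pi))).topologicalClosure := by
    rw [span_fourier_closure_eq_top]; trivial
  obtain ⟨q, hq, hgq⟩ := Metric.mem_closure_iff.1 hg η hη
  have key : ∃ P Q : ℂ → ℂ, Differentiable ℂ P ∧ Differentiable ℂ Q ∧
      ∀ θ, q θ = P (fourier 1 θ) + (starRingEnd ℂ) (Q (fourier 1 θ)) := by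
    clear hgq
    induction hq using Submodule.span_induction with
    | mem q hq =>
      obtain ⟨k, rfl⟩ := hq
      obtain ⟨m, rfl | rfl⟩ := k.eq_nat_or_neg
      · refine ⟨fun w => w ^ m, 0, by fun_prop, differentiable_const 0, fun θ => ?_⟩
        simp [AddCircle.toCircle_nsmul]
      · refine ⟨0, fun w => w ^ m, differentiable_const 0, by fun_prop, fun θ => ?_⟩
        simp [AddCircle.toCircle_neg, AddCircle.toCircle_nsmul, ← Circle.coe_inv_eq_conj]
    | zero => exact ⟨0, 0, differentiable_const 0, differentiable_const 0, by simp⟩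
    | add a b _ _ ha hb =>
      obtain ⟨P, Q, hP, hQ, h⟩ := ha
      obtain ⟨P', Q', hP', hQ', h'⟩ := hb
      refine ⟨P + P', Q + Q', hP.add hP', hQ.add hQ', fun θ => ?_⟩
      simp only [ContinuousMap.add_apply, h, h', Pi.add_apply, map_add]
      ring
    | smul c a _ ha =>
      obtain ⟨P, Q, hP, hQ, h⟩ := ha
      refine ⟨fun w => c * P w, fun w => (starRingEnd ℂ) c * Q w, hP.const_mul _,
        hQ.const_mul _, fun θ => ?_⟩
      simp only [ContinuousMap.smul_apply, h, smul_eq_mul, map_mul, Complex.conj_conj]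
      ring
  obtain ⟨P, Q, hP, hQ, h⟩ := key
  refine ⟨fun τ => P ((τ - x) / r) + Q ((τ - x) / r), by fun_prop, fun τ hτ => ?_⟩
  have hr' : (r : ℂ) ≠ 0 := by exact_mod_cast hr.ne'
  have hnorm : ‖(τ - x) / r‖ = 1 := by
    rw [norm_div, mem_sphere_iff_norm.1 hτ, Complex.norm_real, Real.norm_of_nonneg hr.le,
      div_self hr.ne']
  obtain ⟨θ, hθ⟩ := (AddCircle.homeomorphCircle (T := 2 * Real.pi) Real.two_pi_pos.ne').surjective
    ⟨(τ - x) / r, by simpa [Submonoid.unitSphere] using hnorm⟩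
  have hθ' : fourier 1 θ = (τ - x) / r := by
    rw [fourier_one]
    rw [← AddCircle.homeomorphCircle_apply Real.two_pi_pos.ne', hθ]
  have hτ' : x + r * fourier 1 θ = τ := by rw [hθ']; field_simp; ring
  have h1 := ContinuousMap.dist_apply_le_dist (f := g) (g := q) θ
  rw [dist_eq_norm, h θ] at h1
  have h2 : g θ = (u τ : ℂ) := by simp only [g, ContinuousMap.coe_mk, hτ']
  rw [h2, hθ'] at h1
  refine lt_of_le_of_lt ?_ (lt_of_le_of_lt h1 hgq)
  refine le_trans (le_of_eq ?_) (Complex.abs_re_le_norm _)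
  simp

/-- If `u` cannot be touched from above by a strictly superharmonic paraboloid, then it satisfies
the maximum principle with respect to real parts of entire functions. -/
theorem le_re_of_le_on_sphere {u : ℂ → ℝ} {x : ℂ} {r : ℝ} (hr : 0 < r)
    (hu : ContinuousOn u (closedBall x r))
    (hV : ∀ τ₀ ∈ ball x r, ∀ f : ℂ → ℂ, Differentiable ℂ f → ∀ ε > 0,
      ¬ ∀ᶠ τ in 𝓝 τ₀, u τ ≤ u τ₀ + (f τ - f τ₀).re - ε * ‖τ - τ₀‖ ^ 2)
    {f : ℂ → ℂ} (hf : Differentiable ℂ f) (h : ∀ τ ∈ sphere x r, u τ ≤ (f τ).re) :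
    u x ≤ (f x).re := by
  by_contra! hlt
  set m := u x - (f x).re with hm
  have hm0 : 0 < m := sub_pos.2 hlt
  set ε := m / (2 * r ^ 2) with hε
  have hε0 : 0 < ε := by positivity
  have hεr : ε * r ^ 2 = m / 2 := by rw [hε]; field_simp
  obtain ⟨τ₀, hτ₀, hmax⟩ := (isCompact_closedBall x r).exists_isMaxOn
    ⟨x, mem_closedBall_self hr.le⟩
    (f := fun τ => u τ - (f τ).re + ε * ‖τ - x‖ ^ 2)
    ((hu.sub (Complex.continuous_re.comp hf.continuous).continuousOn).add (by fun_prop))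
  have hx := hmax (mem_closedBall_self hr.le)
  simp only [mem_ofPred_eq, sub_self, norm_zero] at hx
  have hball : τ₀ ∈ ball x r := by
    rcases (mem_closedBall.1 hτ₀).lt_or_eq with h' | h'
    · exact h'
    · exfalso
      have h1 := h τ₀ h'
      rw [← dist_eq_norm, h', hεr] at hx
      linarith
  refine hV τ₀ hball (fun τ => f τ - 2 * ε * (starRingEnd ℂ) (τ₀ - x) * τ) (by fun_prop) ε hε0 ?_
  filter_upwards [isOpen_ball.mem_nhds hball] with τ hτ
  have h1 := hmax (ball_subset_closedBall hτ)
  simp only [mem_ofPred_eq] at h1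
  rw [← Complex.normSq_eq_norm_sq, ← Complex.normSq_eq_norm_sq] at h1
  rw [← Complex.normSq_eq_norm_sq]
  simp only [Complex.normSq_apply, Complex.sub_re, Complex.sub_im, Complex.mul_re, Complex.mul_im,
    Complex.conj_re, Complex.conj_im, Complex.ofReal_re, Complex.ofReal_im, Complex.re_ofNat,
    Complex.im_ofNat] at h1 ⊢
  nlinarith [h1]

/-- A continuous function which cannot be touched from above by a strictly superharmonic paraboloid
is at most its averages over circles. -/
theorem le_circleAverage_of_not_touched {u : ℂ → ℝ} {x : ℂ} {r : ℝ} (hr : 0 < r)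
    (hu : ContinuousOn u (closedBall x r))
    (hV : ∀ τ₀ ∈ ball x r, ∀ f : ℂ → ℂ, Differentiable ℂ f → ∀ ε > 0,
      ¬ ∀ᶠ τ in 𝓝 τ₀, u τ ≤ u τ₀ + (f τ - f τ₀).re - ε * ‖τ - τ₀‖ ^ 2) :
    u x ≤ Real.circleAverage u x r := by
  refine le_of_forall_pos_le_add fun η hη => ?_
  have hus : ContinuousOn u (sphere x r) := hu.mono sphere_subset_closedBall
  obtain ⟨f, hf, hfu⟩ := exists_entire_re_near_on_sphere hr hus (half_pos hη)
  have h1 : u x ≤ ((f x) + (η / 2 : ℝ)).re := by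
    refine le_re_of_le_on_sphere hr hu hV (f := fun τ => f τ + (η / 2 : ℝ)) (by fun_prop) ?_
    intro τ hτ
    have := (abs_lt.1 (hfu τ hτ)).2
    rw [Complex.add_re, Complex.ofReal_re]
    linarith
  have hre : Real.circleAverage (fun τ => (f τ).re) x r = (f x).re := by
    have := Complex.reCLM.circleAverage_comp_comm (f := f) (c := x) (R := r)
      hf.continuous.continuousOn.circleIntegrable'
    rw [hf.diffContOnCl.circleAverage] at this
    exact this
  have hint : CircleIntegrable (fun τ => (f τ).re) x r :=
    (Complex.continuous_re.comp hf.continuous).continuousOn.circleIntegrable hr.le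
  have h2 : Real.circleAverage (fun τ => (f τ).re - η / 2) x r ≤ Real.circleAverage u x r := by
    refine Real.circleAverage_mono
      ((Complex.continuous_re.comp hf.continuous).sub continuous_const
        |>.continuousOn.circleIntegrable hr.le) (hus.circleIntegrable hr.le) ?_
    intro τ hτ
    rw [abs_of_pos hr] at hτ
    have := (abs_lt.1 (hfu τ hτ)).1
    linarith
  rw [Real.circleAverage_fun_sub hint (circleIntegrable_const _ _ _), hre,
    Real.circleAverage_const] at h2
  rw [Complex.add_re, Complex.ofReal_re] at h1
  linarith

/-- Sub-mean value inequalities over circles integrate to one over the disc. -/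
theorem mul_volume_ball_le_integral {u : ℂ → ℝ} {x : ℂ} {r : ℝ}
    (hu : ContinuousOn u (closedBall x r))
    (h : ∀ s, 0 < s → s < r → u x ≤ Real.circleAverage u x s) :
    u x * (volume (ball x r)).toReal ≤ ∫ y in ball x r, u y := by
  have hui : IntegrableOn u (ball x r) :=
    (hu.integrableOn_compact (isCompact_closedBall x r)).mono_set ball_subset_closedBall
  set G : ℂ → ℝ := (ball 0 r).indicator fun y => u (x + y) - u x with hG
  have hGint : ∫ y, G y = (∫ y in ball x r, u y) - u x * (volume (ball x r)).toReal := by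
    have h1 : ∫ y, (ball x r).indicator (fun y => u y - u x) y = ∫ y, G y := by
      rw [← integral_add_left_eq_self _ x]
      refine integral_congr_ae (Eventually.of_forall fun y => ?_)
      simp only [hG, indicator, mem_ball_iff_norm, add_sub_cancel_left, sub_zero]
    rw [← h1, integral_indicator measurableSet_ball,
      integral_sub hui (integrableOn_const measure_ball_lt_top.ne), setIntegral_const,
      smul_eq_mul, mul_comm, measureReal_def]
  have hnonneg : 0 ≤ ∫ y, G y := by
    rw [← Complex.integral_comp_polarCoord_symm]
    by_cases hint : IntegrableOn (fun p : ℝ × ℝ => p.1 • G (Complex.polarCoord.symm p))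
      polarCoord.target
    swap
    · exact (integral_undef hint).ge
    rw [polarCoord_target] at hint ⊢
    rw [Measure.volume_eq_prod] at hint ⊢
    rw [setIntegral_prod _ hint]
    refine setIntegral_nonneg measurableSet_Ioi fun s hs => ?_
    simp only [smul_eq_mul]
    rw [integral_const_mul]
    refine mul_nonneg (le_of_lt hs) ?_
    rcases lt_or_ge s r with hsr | hsr
    · have havg := h s hs hsr
      have hmap : ∀ θ : ℝ, G (Complex.polarCoord.symm (s, θ)) = u (circleMap x s θ) - u x := by
        intro θ
        have h2 : Complex.polarCoord.symm (s, θ) = circleMap 0 s θ := by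
          simp [circleMap, Complex.exp_mul_I]
        have h3 : circleMap 0 s θ ∈ ball (0:ℂ) r := by
          simpa [abs_of_pos (show 0 < s from hs)] using hsr
        rw [h2, hG, indicator_of_mem h3]
        simp [circleMap]
      have hci : CircleIntegrable u x s :=
        (hu.mono (sphere_subset_closedBall.trans
          (closedBall_subset_closedBall hsr.le))).circleIntegrable (le_of_lt hs)
      have hsub : 0 ≤ Real.circleAverage (fun y => u y - u x) x s := by
        rw [Real.circleAverage_fun_sub hci (circleIntegrable_const _ _ _),
          Real.circleAverage_const]
        linarith
      rw [Real.circleAverage_eq_integral_add (-Real.pi), intervalIntegral.integral_comp_add_right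
        (fun θ => u (circleMap x s θ) - u x), zero_add,
        show 2 * Real.pi + -Real.pi = Real.pi by ring,
        intervalIntegral.integral_of_le (by linarith [Real.pi_pos]),
        integral_Ioc_eq_integral_Ioo, smul_eq_mul] at hsub
      simp only [hmap]
      exact (mul_nonneg_iff_of_pos_left (by positivity)).1 hsub
    · refine setIntegral_nonneg measurableSet_Ioo fun θ _ => ?_
      rw [hG, indicator_of_notMem]
      rw [mem_ball_zero_iff, Complex.norm_polarCoord_symm, abs_of_pos hs]
      exact hsr.not_gt
  linarith

/-- Second-derivative test: if `g 0 = 0` and `g t ≤ -c t²` near `0`, then `g' 0 = 0` and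
`g'' 0 ≤ -2c`. -/
theorem deriv_eq_zero_and_deriv_deriv_le {g : ℝ → ℝ} {c : ℝ} (h0 : g 0 = 0)
    (hg : ∀ᶠ t in 𝓝 0, DifferentiableAt ℝ g t) (hg' : DifferentiableAt ℝ (deriv g) 0)
    (hle : ∀ᶠ t in 𝓝 0, g t ≤ -c * t ^ 2) : deriv g 0 = 0 ∧ deriv (deriv g) 0 ≤ -2 * c := by
  set k : ℝ → ℝ := fun t => g t + c * t ^ 2 with hk
  have hkd : ∀ᶠ t in 𝓝 (0:ℝ), deriv k t = deriv g t + 2 * c * t := by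
    filter_upwards [hg] with t ht
    have := ht.hasDerivAt.add (((hasDerivAt_id t).pow 2).const_mul c)
    rw [show deriv k t = _ from this.deriv]
    simp; ring
  have hk0 : k 0 = 0 := by simp [hk, h0]
  have hmax : IsLocalMax k 0 := by
    filter_upwards [hle] with t ht
    rw [hk0]; simp only [hk]; linarith
  have hd0 : deriv k 0 = 0 := hmax.deriv_eq_zero
  have hg0 : deriv g 0 = 0 := by
    have := hkd.self_of_nhds
    simp at this; linarith
  have hdd : deriv (deriv k) 0 = deriv (deriv g) 0 + 2 * c := by
    rw [EventuallyEq.deriv_eq hkd]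
    have := hg'.hasDerivAt.fun_add ((hasDerivAt_id (0:ℝ)).const_mul (2 * c))
    simpa using this.deriv
  refine ⟨hg0, ?_⟩
  by_contra! hlt
  have hpos : 0 < deriv (deriv k) 0 := by rw [hdd]; linarith
  have hkc : ContinuousAt k 0 := by
    have := hg.self_of_nhds.continuousAt
    exact this.add (by fun_prop)
  have hmin := isLocalMin_of_deriv_deriv_pos hpos hd0 hkc
  have hconst : k =ᶠ[𝓝 0] fun _ => k 0 := by
    filter_upwards [hmax, hmin] with t h1 h2 using le_antisymm h1 h2
  have h2 : deriv k =ᶠ[𝓝 0] fun _ => 0 := by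
    filter_upwards [hconst.eventuallyEq_nhds] with t ht
    rw [EventuallyEq.deriv_eq ht]; simp
  rw [EventuallyEq.deriv_eq h2] at hpos
  simp at hpos

/-- Second order necessary conditions along a complex line in the parameter of an entire curve. -/
theorem second_order_along_line {E : Type*} [NormedAddCommGroup E] [NormedSpace ℂ E] [CompleteSpace E]
    {ζ : ℂ → E}
    (hζ : Differentiable ℂ ζ)
    {ρ : E → ℝ} (hρ : ContDiffAt ℝ 2 ρ (ζ 0)) (h0 : ρ (ζ 0) = 0) {c : ℝ}
    (hle : ∀ᶠ τ in 𝓝 (0:ℂ), ρ (ζ τ) ≤ -c * ‖τ‖ ^ 2) {e : ℂ} (he : ‖e‖ = 1) :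
    fderiv ℝ ρ (ζ 0) (e • deriv ζ 0) = 0 ∧
    fderiv ℝ (fun q => fderiv ℝ ρ q (e • deriv ζ 0)) (ζ 0) (e • deriv ζ 0)
      + fderiv ℝ ρ (ζ 0) (e ^ 2 • deriv (deriv ζ) 0) ≤ -2 * c := by
  have hline : ∀ t : ℝ, HasDerivAt (fun t : ℝ => (t : ℂ) * e) e t := fun t => by
    simpa using (Complex.ofRealCLM.hasDerivAt (x := t)).mul_const e
  have hγ : ∀ t : ℝ, HasDerivAt (fun t : ℝ => ζ (t * e)) (e • deriv ζ (t * e)) t := fun t =>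
    (hζ _).hasDerivAt.scomp t (hline t)
  have hγ' : ∀ t : ℝ, HasDerivAt (fun t : ℝ => e • deriv ζ (t * e))
      (e ^ 2 • deriv (deriv ζ) (t * e)) t := fun t => by
    have := ((hζ.deriv (t * e)).hasDerivAt.scomp t (hline t)).const_smul e
    rwa [smul_smul, ← sq] at this
  have hcont : Tendsto (fun t : ℝ => ζ (t * e)) (𝓝 0) (𝓝 (ζ 0)) := by
    have := (hγ 0).continuousAt.tendsto
    simpa using this
  have hρd : ∀ᶠ q in 𝓝 (ζ 0), DifferentiableAt ℝ ρ q := by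
    filter_upwards [hρ.eventually (by simp)] with q hq using hq.differentiableAt (by simp)
  have hg : ∀ᶠ t : ℝ in 𝓝 0, HasDerivAt (fun t : ℝ => ρ (ζ (t * e)))
      (fderiv ℝ ρ (ζ (t * e)) (e • deriv ζ (t * e))) t := by
    filter_upwards [hcont.eventually hρd] with t ht
    exact ht.hasFDerivAt.comp_hasDerivAt t (hγ t)
  have hD : DifferentiableAt ℝ (fderiv ℝ ρ) (ζ 0) :=
    (hρ.fderiv_right (m := 1) (by norm_num)).differentiableAt (by simp)
  have hgg : HasDerivAt (fun t : ℝ => fderiv ℝ ρ (ζ (t * e)) (e • deriv ζ (t * e)))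
      (fderiv ℝ (fderiv ℝ ρ) (ζ 0) (e • deriv ζ 0) (e • deriv ζ 0)
        + fderiv ℝ ρ (ζ 0) (e ^ 2 • deriv (deriv ζ) 0)) 0 := by
    have h1 : HasDerivAt (fun t : ℝ => fderiv ℝ ρ (ζ (t * e)))
        (fderiv ℝ (fderiv ℝ ρ) (ζ 0) (e • deriv ζ 0)) 0 := by
      have := HasFDerivAt.comp_hasDerivAt (l := fderiv ℝ ρ)
        (l' := fderiv ℝ (fderiv ℝ ρ) (ζ 0)) (f := fun t : ℝ => ζ (t * e)) (0:ℝ)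
        (by simpa using hD.hasFDerivAt) (hγ 0)
      simpa [Function.comp_def] using this
    have := h1.clm_apply (hγ' 0)
    simpa using this
  have hdg : deriv (fun t : ℝ => ρ (ζ (t * e))) =ᶠ[𝓝 0]
      fun t : ℝ => fderiv ℝ ρ (ζ (t * e)) (e • deriv ζ (t * e)) := by
    filter_upwards [hg] with t ht using ht.deriv
  have hle' : ∀ᶠ t : ℝ in 𝓝 0, ρ (ζ (t * e)) ≤ -c * t ^ 2 := by
    have ht : Tendsto (fun t : ℝ => (t : ℂ) * e) (𝓝 0) (𝓝 0) := by
      have := (hline 0).continuousAt.tendsto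
      simpa using this
    filter_upwards [ht.eventually hle] with t ht
    simpa [he] using ht
  obtain ⟨h1, h2⟩ := deriv_eq_zero_and_deriv_deriv_le (by simpa using h0)
    (hg.mono fun t ht => ht.differentiableAt)
    (hgg.differentiableAt.congr_of_eventuallyEq hdg) hle'
  rw [hdg.self_of_nhds] at h1
  rw [hdg.deriv_eq, hgg.deriv] at h2
  have h3 : fderiv ℝ (fun q => fderiv ℝ ρ q (e • deriv ζ 0)) (ζ 0) (e • deriv ζ 0) =
      fderiv ℝ (fderiv ℝ ρ) (ζ 0) (e • deriv ζ 0) (e • deriv ζ 0) := by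
    rw [(hD.hasFDerivAt.clm_apply (hasFDerivAt_const (e • deriv ζ 0) (ζ 0))).fderiv]
    simp
  refine ⟨by simpa using h1, by rw [h3]; exact h2⟩

/-- A function that is at most `-c |τ|²` along an entire curve through one of its zeros has a
negative Levi form in some complex tangent direction. -/
theorem levi_neg_of_disc {E : Type*} [NormedAddCommGroup E] [NormedSpace ℂ E] [CompleteSpace E]
    {ζ : ℂ → E}
    (hζ : Differentiable ℂ ζ)
    {ρ : E → ℝ} (hρ : ContDiffAt ℝ 2 ρ (ζ 0)) (h0 : ρ (ζ 0) = 0) {c : ℝ} (hc : 0 < c)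
    (hle : ∀ᶠ τ in 𝓝 (0:ℂ), ρ (ζ τ) ≤ -c * ‖τ‖ ^ 2) :
    ∃ X : E, fderiv ℝ ρ (ζ 0) X = 0 ∧ fderiv ℝ ρ (ζ 0) (Complex.I • X) = 0 ∧
      fderiv ℝ (fun q => fderiv ℝ ρ q X) (ζ 0) X
        + fderiv ℝ (fun q => fderiv ℝ ρ q (Complex.I • X)) (ζ 0) (Complex.I • X) < 0 := by
  obtain ⟨h1, h2⟩ := second_order_along_line hζ hρ h0 hle (e := 1) (by simp)
  obtain ⟨h3, h4⟩ := second_order_along_line hζ hρ h0 hle (e := Complex.I) (by simp)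
  rw [Complex.I_sq, neg_smul, map_neg] at h4
  simp only [one_smul, one_pow] at h1 h2 h4
  exact ⟨deriv ζ 0, h1, h3, by linarith⟩

/-- The distance to the zero set of a function with nonvanishing differential is controlled by
the function. -/
theorem infDist_le_mul_of_fderiv_ne_zero {E : Type*} [NormedAddCommGroup E] [NormedSpace ℝ E]
    {ρ : E → ℝ} {p : E} {V S : Set E}
    (hV : IsOpen V) (hpV : p ∈ V) (hρ : ContDiffOn ℝ 1 ρ V) (hd : fderiv ℝ ρ p ≠ 0)
    (h0 : ρ p = 0) (hS : ∀ q ∈ V, ρ q = 0 → q ∈ S) :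
    ∃ C > 0, ∀ᶠ q in 𝓝 p, ρ q ≤ 0 → infDist q S ≤ C * -ρ q := by
  obtain ⟨N₀, hN₀⟩ : ∃ N, fderiv ℝ ρ p N ≠ 0 := by
    by_contra! h
    exact hd (ContinuousLinearMap.ext h)
  obtain ⟨N, hN⟩ : ∃ N, fderiv ℝ ρ p N = 1 :=
    ⟨(fderiv ℝ ρ p N₀)⁻¹ • N₀, by simp [hN₀]⟩
  have hN0 : 0 < ‖N‖ := norm_pos_iff.2 fun h => by simp [h] at hN
  have hρp : ContDiffAt ℝ 1 ρ p := hρ.contDiffAt (hV.mem_nhds hpV)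
  have hstrict := (hρp.hasStrictFDerivAt (by simp)).isLittleO.def
    (show (0:ℝ) < 1 / (2 * ‖N‖) by positivity)
  rw [nhds_prod_eq] at hstrict
  obtain ⟨t, ht, hts⟩ := Filter.mem_prod_same_iff.1 hstrict
  obtain ⟨r, hr, hrt⟩ := Metric.mem_nhds_iff.1 (inter_mem ht (hV.mem_nhds hpV))
  refine ⟨2 * ‖N‖, by positivity, ?_⟩
  have hρc : Tendsto (fun q => ‖q - p‖ + 2 * ‖N‖ * -ρ q) (𝓝 p) (𝓝 0) := by
    have : ContinuousAt (fun q => ‖q - p‖ + 2 * ‖N‖ * -ρ q) p := by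
      have := hρp.continuousAt
      fun_prop
    simpa [ContinuousAt, h0] using this
  filter_upwards [hρc.eventually (gt_mem_nhds hr)] with q hq hq0
  set T := 2 * -ρ q with hT
  have hT0 : 0 ≤ T := by linarith
  have hseg : ∀ s ∈ Icc 0 T, q + s • N ∈ ball p r := by
    intro s hs
    rw [mem_ball_iff_norm]
    have h1 : ‖q + s • N - p‖ ≤ ‖q - p‖ + s * ‖N‖ := by
      rw [show q + s • N - p = (q - p) + s • N by abel]
      refine (norm_add_le _ _).trans ?_
      rw [norm_smul, Real.norm_of_nonneg hs.1]
    have h2 : s * ‖N‖ ≤ T * ‖N‖ := by gcongr; exact hs.2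
    have h3 : T * ‖N‖ = 2 * ‖N‖ * -ρ q := by rw [hT]; ring
    linarith
  have hcont : ContinuousOn (fun s : ℝ => ρ (q + s • N)) (Icc 0 T) :=
    hρ.continuousOn.comp (by fun_prop) fun s hs => (hrt (hseg s hs)).2
  have hend : 0 ≤ ρ (q + T • N) := by
    have hmem : (q + T • N, q) ∈ t ×ˢ t :=
      ⟨(hrt (hseg T ⟨hT0, le_rfl⟩)).1, by simpa using (hrt (hseg 0 ⟨le_rfl, hT0⟩)).1⟩
    have := hts hmem
    simp only [mem_ofPred_eq, add_sub_cancel_left, map_smul, hN, smul_eq_mul, mul_one, norm_smul,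
      Real.norm_of_nonneg hT0] at this
    have h1 : 1 / (2 * ‖N‖) * (T * ‖N‖) = T / 2 := by field_simp
    rw [h1] at this
    have := (abs_le.1 this).1
    linarith
  obtain ⟨s, hs, hs0⟩ := intermediate_value_Icc hT0 hcont
    (show (0:ℝ) ∈ Icc _ _ from ⟨by simpa using hq0, hend⟩)
  have hsS := hS _ (hrt (hseg s hs)).2 hs0
  calc infDist q S ≤ dist q (q + s • N) := infDist_le_dist_of_mem hsS
    _ = s * ‖N‖ := by simp [norm_smul, abs_of_nonneg hs.1]
    _ ≤ T * ‖N‖ := by gcongr; exact hs.2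
    _ = 2 * ‖N‖ * -ρ q := by rw [hT]; ring

/-- The ball about a point of an open set with radius the distance to the boundary lies in the
set. -/
theorem ball_infDist_frontier_subset {E : Type*} [NormedAddCommGroup E] [NormedSpace ℝ E]
    {Ω : Set E} (hΩ : IsOpen Ω) {z : E}
    (hz : z ∈ Ω) : ball z (infDist z (frontier Ω)) ⊆ Ω := by
  rcases le_or_gt (infDist z (frontier Ω)) 0 with h | h
  · simp [ball_eq_empty.2 h]
  refine (convex_ball z _).isPreconnected.subset_left_of_subset_union (v := (closure Ω)ᶜ) hΩ
    isClosed_closure.isOpen_compl (disjoint_compl_right_iff_subset.2 subset_closure) ?_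
    ⟨z, mem_ball_self h, hz⟩
  intro y hy
  by_contra hy'
  simp only [mem_union, mem_compl_iff, not_or, not_not] at hy'
  have hyf : y ∈ frontier Ω := by rw [hΩ.frontier_eq]; exact ⟨hy'.2, hy'.1⟩
  have := infDist_le_dist_of_mem (x := z) hyf
  rw [mem_ball'] at hy
  linarith

/-- For an integrable real function, `erealBallAvg` is bounded below by real averages. -/
theorem coe_le_erealBallAvg {u : ℂ → ℝ} {x : ℂ} {r : ℝ} (hr : 0 < r)
    (hu : IntegrableOn u (ball x r))
    (h : u x * (volume (ball x r)).toReal ≤ ∫ y in ball x r, u y) :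
    ((u x : ℝ) : EReal) ≤ erealBallAvg (fun y => ((u y : ℝ) : EReal)) x r := by
  have hV : 0 < (volume (ball x r)).toReal :=
    ENNReal.toReal_pos (measure_ball_pos _ _ hr).ne' measure_ball_lt_top.ne
  have hA : ∫⁻ y in ball x r, ENNReal.ofReal (u y) ≠ ⊤ := hu.lintegral_lt_top.ne
  have hB : ∫⁻ y in ball x r, ENNReal.ofReal (-u y) ≠ ⊤ := hu.neg.lintegral_lt_top.ne
  have hV0 : volume (ball x r) ≠ 0 := (measure_ball_pos _ _ hr).ne'
  have e1 : ∀ y : ℝ, erealToENNReal (y : EReal) = ENNReal.ofReal y := fun y => by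
    simp [erealToENNReal]
  simp only [erealBallAvg, ← EReal.coe_neg, e1]
  rw [← EReal.coe_ennreal_toReal (ENNReal.div_ne_top hA hV0),
    ← EReal.coe_ennreal_toReal (ENNReal.div_ne_top hB hV0), ← EReal.coe_sub,
    EReal.coe_le_coe_iff, ENNReal.toReal_div, ENNReal.toReal_div, ← sub_div, le_div_iff₀ hV,
    ← integral_eq_lintegral_pos_part_sub_lintegral_neg_part hu]
  exact h

/-- For a Levi pseudoconvex domain, `-log d` cannot be touched from above along a complex line
by a strictly superharmonic paraboloid: otherwise the discs of radius `d` centred on the line would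
carry a holomorphic disc tangent to the boundary that violates the Levi condition. -/
theorem LeviPseudoconvex.neg_log_infDist_not_touched {n : ℕ}
    {Ω : Set (EuclideanSpace ℂ (Fin n))} (hlevi : LeviPseudoconvex Ω) (hopen : IsOpen Ω)
    (hsmooth : HasCkBoundary Ω 2) (hne : (frontier Ω).Nonempty)
    {a b : EuclideanSpace ℂ (Fin n)} {τ₀ : ℂ} (hτ₀ : a + τ₀ • b ∈ Ω)
    {f : ℂ → ℂ} (hf : Differentiable ℂ f) {ε : ℝ} (hε : 0 < ε) :
    ¬ ∀ᶠ τ in 𝓝 τ₀, -Real.log (infDist (a + τ • b) (frontier Ω)) ≤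
      -Real.log (infDist (a + τ₀ • b) (frontier Ω)) + (f τ - f τ₀).re - ε * ‖τ - τ₀‖ ^ 2 := by
  intro htouch
  set z := a + τ₀ • b with hz
  have hδ : ∀ y ∈ Ω, 0 < infDist y (frontier Ω) := fun y hy =>
    (isClosed_frontier.notMem_iff_infDist_pos hne).1 fun h => by
      rw [hopen.frontier_eq] at h; exact h.2 hy
  obtain ⟨p, hp, hpz⟩ := isClosed_frontier.exists_infDist_eq_dist hne z
  obtain ⟨V, ρ, hρ⟩ := hsmooth p hp
  have hlev := hlevi p hp V ρ hρ
  obtain ⟨hVo, hpV, hρd, hρ1, hρ2, hρ3⟩ := hρ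
  have hρp : ρ p = 0 := (hρ3 ▸ (⟨hp, hpV⟩ : p ∈ frontier Ω ∩ V) :
    p ∈ {q | q ∈ V ∧ ρ q = 0}).2
  obtain ⟨C, hC, hdist⟩ := infDist_le_mul_of_fderiv_ne_zero hVo hpV
    (hρd.of_le (by norm_num)) (hρ1 p ⟨hpV, hp⟩) hρp (S := frontier Ω) fun q hq hq0 =>
      (hρ3.symm ▸ (⟨hq, hq0⟩ : q ∈ {q | q ∈ V ∧ ρ q = 0}) : q ∈ frontier Ω ∩ V).1
  set F : ℂ → ℂ := fun τ => f τ₀ - f (τ₀ + τ) with hF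
  have hFd : Differentiable ℂ F := by fun_prop
  set ζ : ℂ → EuclideanSpace ℂ (Fin n) := fun τ => z + τ • b + Complex.exp (F τ) • (p - z) with hζ
  have hζd : Differentiable ℂ ζ := by fun_prop
  have hζ0 : ζ 0 = p := by simp [hζ, hF]
  set δ := infDist z (frontier Ω)
  have hδ0 : 0 < δ := hδ z hτ₀
  have hshift : Tendsto (fun τ : ℂ => τ₀ + τ) (𝓝 0) (𝓝 τ₀) := by
    have : Continuous fun τ : ℂ => τ₀ + τ := by fun_prop
    simpa using this.tendsto 0
  have hζt : Tendsto ζ (𝓝 0) (𝓝 p) := hζ0 ▸ hζd.continuous.tendsto 0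
  have hin : ∀ᶠ τ : ℂ in 𝓝 0, z + τ • b ∈ Ω := by
    have : Continuous fun τ : ℂ => z + τ • b := by fun_prop
    exact this.tendsto 0 (by simpa using hopen.mem_nhds hτ₀)
  have hhalf : ∀ᶠ τ : ℂ in 𝓝 0, 1 / 2 < ‖Complex.exp (F τ)‖ := by
    have : Continuous fun τ : ℂ => ‖Complex.exp (F τ)‖ := by
      have := hFd.continuous
      fun_prop
    refine (this.tendsto 0).eventually (lt_mem_nhds ?_)
    simp only [hF, add_zero, sub_self, Complex.exp_zero, norm_one]
    norm_num
  have hle : ∀ᶠ τ in 𝓝 (0:ℂ), ρ (ζ τ) ≤ -(δ * ε / 2 / C) * ‖τ‖ ^ 2 := by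
    filter_upwards [hshift.eventually htouch, hin, hhalf, hζt.eventually hdist,
      hζt.eventually (hVo.eventually_mem hpV)] with τ h1 h2 h3 h4 h5
    rcases eq_or_ne τ 0 with rfl | hτ
    · rw [hζ0, hρp]; simp
    rw [show a + (τ₀ + τ) • b = z + τ • b by rw [hz, add_smul, add_assoc],
      add_sub_cancel_left] at h1
    set e := ‖Complex.exp (F τ)‖ with he
    have hτ2 : 0 < ‖τ‖ ^ 2 := by positivity
    have h6 : δ * e * (1 + ε * ‖τ‖ ^ 2) ≤ infDist (z + τ • b) (frontier Ω) := by
      calc δ * e * (1 + ε * ‖τ‖ ^ 2) ≤ δ * e * Real.exp (ε * ‖τ‖ ^ 2) := by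
            gcongr
            linarith [Real.add_one_le_exp (ε * ‖τ‖ ^ 2)]
        _ = Real.exp (Real.log δ + (F τ).re + ε * ‖τ‖ ^ 2) := by
            rw [Real.exp_add, Real.exp_add, Real.exp_log hδ0, he, Complex.norm_exp]
        _ ≤ Real.exp (Real.log (infDist (z + τ • b) (frontier Ω))) := by
            apply Real.exp_le_exp.2
            simp only [hF, Complex.sub_re] at h1 ⊢
            linarith
        _ = _ := Real.exp_log (hδ _ h2)
    have h7 : dist (z + τ • b) (ζ τ) = e * δ := by
      rw [hpz, dist_comm, dist_eq_norm, dist_comm z p, dist_eq_norm]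
      simp only [hζ, add_sub_cancel_left, norm_smul, he]
    have h8 : δ * ε / 2 * ‖τ‖ ^ 2 ≤ infDist (z + τ • b) (frontier Ω) - e * δ := by
      have : 0 ≤ (e - 1 / 2) * (δ * ε * ‖τ‖ ^ 2) :=
        mul_nonneg (by linarith) (by positivity)
      nlinarith
    have h9 : 0 < δ * ε / 2 * ‖τ‖ ^ 2 := by positivity
    have h10 : ζ τ ∈ Ω := ball_infDist_frontier_subset hopen h2 (by
      rw [mem_ball', h7]; linarith)
    have h11 : ρ (ζ τ) < 0 := (hρ2 ▸ (⟨h10, h5⟩ : ζ τ ∈ Ω ∩ V) :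
      ζ τ ∈ {q | q ∈ V ∧ ρ q < 0}).2
    have h12 := h4 h11.le
    have h13 := infDist_le_infDist_add_dist (s := frontier Ω) (x := z + τ • b) (y := ζ τ)
    rw [h7] at h13
    have h14 : δ * ε / 2 / C * ‖τ‖ ^ 2 ≤ -ρ (ζ τ) := by
      rw [div_mul_eq_mul_div, div_le_iff₀ hC]
      linarith
    linarith
  obtain ⟨X, hX1, hX2, hX3⟩ := levi_neg_of_disc hζd
    (hζ0.symm ▸ hρd.contDiffAt (hVo.mem_nhds hpV)) (hζ0.symm ▸ hρp) (by positivity) hle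
  rw [hζ0] at hX1 hX2 hX3
  exact hX3.not_ge (hlev X hX1 hX2)

/-- Theorem (statement 1, Herbig–McNeal): if `Ω ⊆ ℂⁿ` is a bounded domain with smooth
boundary which is Levi pseudoconvex, then there is an open neighborhood `U` of `∂Ω` such that
`z ↦ -log(d_{∂Ω}(z))` is plurisubharmonic on `Ω ∩ U`. -/
theorem herbig_mcneal (n : ℕ) (Ω : Set (EuclideanSpace ℂ (Fin n)))
    (hopen : IsOpen Ω) (hconn : IsConnected Ω) (hbdd : Bornology.IsBounded Ω)
    (hsmooth : HasCkBoundary Ω ⊤) (hlevi : LeviPseudoconvex Ω) :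
    ∃ U : Set (EuclideanSpace ℂ (Fin n)), IsOpen U ∧ frontier Ω ⊆ U ∧
      IsPlurisubharmonicOn
        (fun z => ((- Real.log (infDist z (frontier Ω)) : ℝ) : EReal)) (Ω ∩ U) := by
  refine ⟨univ, isOpen_univ, subset_univ _, ?_⟩
  rw [inter_univ]
  have hcont : ContinuousOn (fun z => -Real.log (infDist z (frontier Ω))) Ω := by
    rcases (frontier Ω).eq_empty_or_nonempty with hF | hF
    · simp only [hF, infDist_empty]
      exact continuousOn_const
    · refine ((continuous_infDist_pt _).continuousOn.log fun z hz => ?_).neg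
      refine ((isClosed_frontier.notMem_iff_infDist_pos hF).1 fun h => ?_).ne'
      rw [hopen.frontier_eq] at h
      exact h.2 hz
  refine ⟨(continuous_coe_real_ereal.comp_continuousOn hcont).upperSemicontinuousOn, ?_,
    fun z _ => EReal.coe_lt_top _, fun a b x hx => ⟨1, one_pos, fun r hr _ hball => ?_⟩⟩
  · obtain ⟨z, hz⟩ := hconn.nonempty
    exact fun h => EReal.coe_ne_bot _ (h z hz)
  have hu : ContinuousOn (fun w : ℂ => -Real.log (infDist (a + w • b) (frontier Ω)))
      (closedBall x r) := hcont.comp (by fun_prop) hball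
  refine coe_le_erealBallAvg (u := fun w => -Real.log (infDist (a + w • b) (frontier Ω))) hr
    ((hu.integrableOn_compact (isCompact_closedBall x r)).mono_set ball_subset_closedBall) ?_
  refine mul_volume_ball_le_integral hu fun s hs hsr => ?_
  rcases (frontier Ω).eq_empty_or_nonempty with hF | hF
  · simp only [hF, infDist_empty, Real.circleAverage_const, le_refl]
  have hsub := closedBall_subset_closedBall (x := x) hsr.le
  refine le_circleAverage_of_not_touched hs (hu.mono hsub) fun τ₀ hτ₀ f hf ε hε => ?_
  refine hlevi.neg_log_infDist_not_touched hopen (fun p hp => ?_) hF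
    (hball (hsub (ball_subset_closedBall hτ₀))) hf hε
  obtain ⟨V, ρ, h1, h2, h3, h4⟩ := hsmooth p hp
  exact ⟨V, ρ, h1, h2, h3.of_le (by exact_mod_cast le_top), h4⟩

end
end

section
/- Let Ω ⊂ ℂⁿ be a bounded domain with smooth boundary which is Levi pseudoconvex, and let Σ be the cut locus of Ω. Then the function z ↦ -log(d_{∂Ω}(z)) is plurisubharmonic on Ω \ Σ. -/
open MeasureTheory Metric Filter Topology Set
open scoped ENNReal

noncomputable section

variable {E : Type*} [NormedAddCommGroup E] [MeasureSpace E]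

/-- The medial axis of `Ω`: points of `Ω` with more than one nearest boundary point. -/
def medialAxis {X : Type*} [MetricSpace X] (Ω : Set X) : Set X :=
  {x ∈ Ω | ∃ y ∈ frontier Ω, ∃ z ∈ frontier Ω, y ≠ z ∧
    dist x y = infDist x (frontier Ω) ∧ dist x z = infDist x (frontier Ω)}

/-- The cut locus of `Ω`: the closure of the medial axis in `Ω`. -/
def cutLocus {X : Type*} [MetricSpace X] (Ω : Set X) : Set X :=
  closure (medialAxis Ω) ∩ Ω

/-- The lower four-point Laplacian of `v` at `z` is nonnegative. -/
def FourPointLaplacianNonneg (v : ℂ → ℝ) (z : ℂ) : Prop :=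
  ∀ ε > 0, ∀ᶠ w in 𝓝 (0 : ℂ), 4 * v z - ε * ‖w‖ ^ 2 ≤
    v (z + w) + v (z - w) + v (z + Complex.I * w) + v (z - Complex.I * w)

lemma sum_four_norm_sq (a w : ℂ) :
    ‖a + w‖ ^ 2 + ‖a - w‖ ^ 2 + ‖a + Complex.I * w‖ ^ 2 + ‖a - Complex.I * w‖ ^ 2
      = 4 * ‖a‖ ^ 2 + 4 * ‖w‖ ^ 2 := by
  simp only [← Complex.normSq_eq_norm_sq, Complex.normSq_apply]
  simp
  ring

/-- Maximum principle: the value at the center is dominated by some value on the circle. -/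
lemma exists_sphere_le_of_fourPoint {v : ℂ → ℝ} {c : ℂ} {r : ℝ} (hr : 0 ≤ r)
    (hv : ContinuousOn v (closedBall c r))
    (hL : ∀ z ∈ ball c r, FourPointLaplacianNonneg v z) :
    ∃ z ∈ sphere c r, v c ≤ v z := by
  rcases hr.eq_or_lt with rfl | hr
  · exact ⟨c, by simp, le_rfl⟩
  by_contra! hcon
  obtain ⟨z₁, hz₁, hmax₁⟩ := (isCompact_sphere c r).exists_isMaxOn
    (NormedSpace.sphere_nonempty.2 hr.le) (hv.mono sphere_subset_closedBall)
  have hlt := hcon z₁ hz₁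
  obtain ⟨δ, hδ, hδr⟩ : ∃ δ > 0, δ * r ^ 2 < v c - v z₁ := by
    refine ⟨(v c - v z₁) / (2 * r ^ 2), by have := sub_pos.2 hlt; positivity, ?_⟩
    have : (v c - v z₁) / (2 * r ^ 2) * r ^ 2 = (v c - v z₁) / 2 := by field_simp
    linarith
  have hcont : ContinuousOn (fun z => v z + δ * ‖z - c‖ ^ 2) (closedBall c r) :=
    hv.add (by fun_prop)
  obtain ⟨z₀, hz₀, hmax⟩ := (isCompact_closedBall c r).exists_isMaxOn
    (nonempty_closedBall.2 hr.le) hcont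
  have hc := hmax (mem_closedBall_self hr.le)
  simp only [sub_self, norm_zero, mem_ofPred_eq] at hc
  have hz₀b : z₀ ∈ ball c r := by
    refine mem_ball.2 (lt_of_le_of_ne (mem_closedBall.1 hz₀) fun h => ?_)
    have h1 := hmax₁ (mem_sphere.2 h)
    rw [dist_eq_norm] at h
    simp only [mem_ofPred_eq] at h1
    rw [h] at hc
    linarith
  have hnhds : ∀ g : ℂ → ℂ, Continuous g → g 0 = z₀ → ∀ᶠ w in 𝓝 (0 : ℂ), g w ∈ ball c r :=
    fun g hg h0 => hg.continuousAt.eventually_mem (by rw [h0]; exact isOpen_ball.mem_nhds hz₀b)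
  have hev := (hL z₀ hz₀b δ hδ).and <| (hnhds (fun w => z₀ + w) (by fun_prop) (by simp)).and <|
    (hnhds (fun w => z₀ - w) (by fun_prop) (by simp)).and <|
    (hnhds (fun w => z₀ + Complex.I * w) (by fun_prop) (by simp)).and
    (hnhds (fun w => z₀ - Complex.I * w) (by fun_prop) (by simp))
  obtain ⟨w, ⟨h0, h1, h2, h3, h4⟩, hw⟩ :=
    ((hev.filter_mono nhdsWithin_le_nhds).and (self_mem_nhdsWithin (s := {(0 : ℂ)}ᶜ))).exists
  have k1 := hmax (ball_subset_closedBall h1)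
  have k2 := hmax (ball_subset_closedBall h2)
  have k3 := hmax (ball_subset_closedBall h3)
  have k4 := hmax (ball_subset_closedBall h4)
  simp only [mem_ofPred_eq] at k1 k2 k3 k4
  have hs := sum_four_norm_sq (z₀ - c) w
  rw [show z₀ + w - c = z₀ - c + w by ring] at k1
  rw [show z₀ - w - c = z₀ - c - w by ring] at k2
  rw [show z₀ + Complex.I * w - c = z₀ - c + Complex.I * w by ring] at k3
  rw [show z₀ - Complex.I * w - c = z₀ - c - Complex.I * w by ring] at k4
  have hs' : δ * ‖z₀ - c + w‖ ^ 2 + δ * ‖z₀ - c - w‖ ^ 2 + δ * ‖z₀ - c + Complex.I * w‖ ^ 2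
      + δ * ‖z₀ - c - Complex.I * w‖ ^ 2 = 4 * (δ * ‖z₀ - c‖ ^ 2) + 4 * (δ * ‖w‖ ^ 2) := by
    linear_combination δ * hs
  have hpos : 0 < δ * ‖w‖ ^ 2 := mul_pos hδ (pow_pos (norm_pos_iff.2 hw) 2)
  linarith

/-- The sum of `v` over the points `c + ζ w`, with `ζ` running over the `n`-th roots of unity. -/
def rotationSum (v : ℂ → ℝ) (c : ℂ) (n : ℕ) [NeZero n] (w : ℂ) : ℝ :=
  ∑ k : ZMod n, v (c + (ZMod.toCircle k : ℂ) * w)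

lemma FourPointLaplacianNonneg.rotationSum {v : ℂ → ℝ} {c w : ℂ} {n : ℕ} [NeZero n]
    (hL : ∀ k : ZMod n, FourPointLaplacianNonneg v (c + (ZMod.toCircle k : ℂ) * w)) :
    FourPointLaplacianNonneg (rotationSum v c n) w := by
  intro ε hε
  have hn : (0 : ℝ) < n := by exact_mod_cast Nat.pos_of_ne_zero (NeZero.ne n)
  have hev : ∀ᶠ h in 𝓝 (0 : ℂ), ∀ k : ZMod n,
      4 * v (c + (ZMod.toCircle k : ℂ) * w) - ε / n * ‖h‖ ^ 2 ≤
        v (c + (ZMod.toCircle k : ℂ) * (w + h)) + v (c + (ZMod.toCircle k : ℂ) * (w - h))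
        + v (c + (ZMod.toCircle k : ℂ) * (w + Complex.I * h))
        + v (c + (ZMod.toCircle k : ℂ) * (w - Complex.I * h)) := by
    refine eventually_all.2 fun k => ?_
    have ht : Tendsto (fun h : ℂ => (ZMod.toCircle k : ℂ) * h) (𝓝 0) (𝓝 0) := by
      have : Continuous fun h : ℂ => (ZMod.toCircle k : ℂ) * h := by fun_prop
      simpa using this.tendsto 0
    filter_upwards [ht.eventually (hL k (ε / n) (by positivity))] with h hh
    rw [norm_mul, Circle.norm_coe, one_mul] at hh
    simpa only [mul_add, mul_sub, ← add_assoc, ← add_sub_assoc, mul_left_comm _ Complex.I] using hh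
  filter_upwards [hev] with h hh
  have := Finset.sum_le_sum fun k (_ : k ∈ Finset.univ) => hh k
  simp only [Finset.sum_add_distrib, Finset.sum_sub_distrib, ← Finset.mul_sum, Finset.sum_const,
    Finset.card_univ, ZMod.card, nsmul_eq_mul] at this
  have he : ε / n * (n * ‖h‖ ^ 2) = ε * ‖h‖ ^ 2 := by field_simp
  rw [he] at this
  exact this

lemma exists_toCircle_dist_le (n : ℕ) [NeZero n] {w z : ℂ} (h : ‖z‖ = ‖w‖) :
    ∃ j : ZMod n, ‖z - (ZMod.toCircle j : ℂ) * w‖ ≤ 2 * Real.pi / n * ‖w‖ := by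
  rcases eq_or_ne w 0 with rfl | hw
  · exact ⟨0, by simp_all⟩
  have hn : (0 : ℝ) < n := by exact_mod_cast Nat.pos_of_ne_zero (NeZero.ne n)
  set θ := Complex.arg (z / w)
  have hz : z = Complex.exp (θ * Complex.I) * w := by
    have h1 := Complex.norm_mul_exp_arg_mul_I (z / w)
    rw [norm_div, h, div_self (norm_ne_zero_iff.2 hw), Complex.ofReal_one, one_mul] at h1
    rw [h1, div_mul_cancel₀ _ hw]
  set j : ℤ := ⌊θ * n / (2 * Real.pi)⌋
  refine ⟨(j : ZMod n), ?_⟩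
  have hpi := Real.pi_pos
  set φ : ℝ := 2 * Real.pi * j / n
  have hφ : (ZMod.toCircle (j : ZMod n) : ℂ) = Complex.exp (φ * Complex.I) := by
    rw [ZMod.toCircle_intCast]
    congr 1
    simp only [φ]
    push_cast
    ring
  have hd : |θ - φ| ≤ 2 * Real.pi / n := by
    have h1 : (j : ℝ) ≤ θ * n / (2 * Real.pi) := Int.floor_le _
    have h2 : θ * n / (2 * Real.pi) < j + 1 := Int.lt_floor_add_one _
    have e : θ - φ = 2 * Real.pi / n * (θ * n / (2 * Real.pi) - j) := by
      simp only [φ]; field_simp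
    rw [e, abs_mul, abs_of_pos (by positivity : 0 < 2 * Real.pi / n)]
    refine mul_le_of_le_one_right (by positivity) ?_
    rw [abs_le]; constructor <;> linarith
  rw [hφ, hz, ← sub_mul, norm_mul]
  refine mul_le_mul_of_nonneg_right (le_trans ?_ hd) (norm_nonneg _)
  have e : Complex.exp (θ * Complex.I) - Complex.exp (φ * Complex.I)
      = Complex.exp (φ * Complex.I) * (Complex.exp (Complex.I * (θ - φ : ℝ)) - 1) := by
    rw [mul_sub, ← Complex.exp_add, mul_one]
    congr 2
    push_cast
    ring
  rw [e, norm_mul, Complex.norm_exp_ofReal_mul_I, one_mul]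
  exact Real.norm_exp_I_mul_ofReal_sub_one_le

lemma exists_rotationSum_ge {v : ℂ → ℝ} {c : ℂ} {r : ℝ}
    (hv : ContinuousOn v (closedBall c r))
    (hL : ∀ z ∈ ball c r, FourPointLaplacianNonneg v z) {δ : ℝ} (hδ : 0 < δ) :
    ∃ (n : ℕ) (_ : NeZero n), ∀ w ∈ closedBall (0 : ℂ) r,
      n * (v c - δ) ≤ rotationSum v c n w := by
  obtain ⟨η, hη, hunif⟩ := Metric.uniformContinuousOn_iff.1
    ((isCompact_closedBall c r).uniformContinuousOn_of_continuous hv) δ hδ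
  obtain ⟨m, hm⟩ := exists_nat_gt (2 * Real.pi * r / η)
  refine ⟨m + 1, ⟨by omega⟩, fun w hw => ?_⟩
  rw [mem_closedBall_zero_iff] at hw
  have hmem : ∀ (ζ : Circle) {u : ℂ} {s : ℝ}, u ∈ closedBall 0 s → c + ζ * u ∈ closedBall c s := by
    intro ζ u s hu
    rw [mem_closedBall_zero_iff] at hu
    rwa [mem_closedBall_iff_norm, add_sub_cancel_left, norm_mul, Circle.norm_coe, one_mul]
  have hmem' : ∀ (ζ : Circle) {u : ℂ} {s : ℝ}, u ∈ ball 0 s → c + ζ * u ∈ ball c s := by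
    intro ζ u s hu
    rw [mem_ball_zero_iff] at hu
    rwa [mem_ball_iff_norm, add_sub_cancel_left, norm_mul, Circle.norm_coe, one_mul]
  obtain ⟨z, hz, hle⟩ := exists_sphere_le_of_fourPoint (v := rotationSum v c (m + 1)) (c := 0)
    (norm_nonneg w)
    (by
      unfold rotationSum
      refine continuousOn_finsetSum _ fun k _ => hv.comp (by fun_prop) fun u hu => ?_
      exact hmem _ (closedBall_subset_closedBall hw hu))
    (fun u hu => FourPointLaplacianNonneg.rotationSum fun k =>
      hL _ (hmem' _ (ball_subset_ball hw hu)))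
  rw [mem_sphere_zero_iff_norm] at hz
  obtain ⟨j, hj⟩ := exists_toCircle_dist_le (m + 1) hz
  have hlt : ‖z - (ZMod.toCircle j : ℂ) * w‖ < η := by
    refine hj.trans_lt ?_
    push_cast
    rw [div_lt_iff₀ hη] at hm
    have hpi := Real.pi_pos
    calc 2 * Real.pi / (m + 1) * ‖w‖ ≤ 2 * Real.pi / (m + 1) * r := by gcongr
      _ = (2 * Real.pi * r) / (m + 1) := by ring
      _ < η := by rw [div_lt_iff₀ (by positivity)]; nlinarith
  have hstep : rotationSum v c (m + 1) z ≤ rotationSum v c (m + 1) w + (m + 1 : ℕ) * δ := by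
    have hre : rotationSum v c (m + 1) w
        = ∑ k : ZMod (m + 1), v (c + (ZMod.toCircle (k + j) : ℂ) * w) :=
      (Fintype.sum_equiv (Equiv.addRight j) _ _ fun k => rfl).symm
    have hcard : ((m + 1 : ℕ) : ℝ) * δ = ∑ _k : ZMod (m + 1), δ := by simp
    rw [hre, hcard, ← Finset.sum_add_distrib]
    refine Finset.sum_le_sum fun k _ => ?_
    have hd := hunif (c + (ZMod.toCircle k : ℂ) * z)
      (hmem _ (by rw [mem_closedBall_zero_iff, hz]; exact hw))
      (c + (ZMod.toCircle (k + j) : ℂ) * w)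
      (hmem _ (by rw [mem_closedBall_zero_iff]; exact hw)) (by
        rw [dist_eq_norm, AddChar.map_add_eq_mul, Circle.coe_mul]
        calc _ = ‖(ZMod.toCircle k : ℂ) * (z - (ZMod.toCircle j : ℂ) * w)‖ := by ring_nf
          _ < η := by rwa [norm_mul, Circle.norm_coe, one_mul])
    rw [Real.dist_eq] at hd
    linarith [(abs_lt.1 hd).2]
  have h0 : rotationSum v c (m + 1) 0 = (m + 1 : ℕ) * v c := by simp [rotationSum]
  rw [h0] at hle
  linarith

/-- A continuous function with nonnegative lower four-point Laplacian satisfies the sub-mean value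
inequality on discs. -/
lemma mul_volume_le_setIntegral_ball {v : ℂ → ℝ} {c : ℂ} {r : ℝ}
    (hv : ContinuousOn v (closedBall c r))
    (hL : ∀ z ∈ ball c r, FourPointLaplacianNonneg v z) :
    v c * volume.real (ball c r) ≤ ∫ z in ball c r, v z := by
  have hint : IntegrableOn v (ball c r) :=
    (hv.integrableOn_compact (isCompact_closedBall c r)).mono_set ball_subset_closedBall
  have hmp : ∀ ζ : Circle, MeasurePreserving (fun w : ℂ => c + ζ * w) := fun ζ =>
    (measurePreserving_add_left volume c).comp (rotation ζ).measurePreserving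
  have hemb : ∀ ζ : Circle, MeasurableEmbedding (fun w : ℂ => c + ζ * w) := fun ζ =>
    ((Homeomorph.addLeft c).measurableEmbedding).comp
      (rotation ζ).toHomeomorph.measurableEmbedding
  have hpre : ∀ ζ : Circle, (fun w : ℂ => c + ζ * w) ⁻¹' ball c r = ball 0 r := by
    intro ζ
    ext w
    rw [mem_preimage, mem_ball_iff_norm, add_sub_cancel_left, norm_mul, Circle.norm_coe, one_mul,
      mem_ball_zero_iff]
  have hi : ∀ ζ : Circle, IntegrableOn (fun w : ℂ => v (c + ζ * w)) (ball 0 r) := fun ζ => by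
    rw [← hpre ζ]
    exact ((hmp ζ).integrableOn_comp_preimage (hemb ζ)).2 hint
  have hvol : volume.real (ball (0 : ℂ) r) = volume.real (ball c r) := by
    simp [measureReal_def]
  have key : ∀ δ > 0, (v c - δ) * volume.real (ball c r) ≤ ∫ z in ball c r, v z := by
    intro δ hδ
    obtain ⟨n, hn, h⟩ := exists_rotationSum_ge hv hL hδ
    have hn0 : (0 : ℝ) < n := by exact_mod_cast Nat.pos_of_ne_zero (NeZero.ne n)
    have e : ∫ w in ball (0 : ℂ) r, rotationSum v c n w = n * ∫ z in ball c r, v z := by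
      unfold rotationSum
      rw [integral_finsetSum _ fun k _ => hi _]
      have : ∀ k : ZMod n, ∫ w in ball (0 : ℂ) r, v (c + (ZMod.toCircle k : ℂ) * w)
          = ∫ z in ball c r, v z := fun k => by
        rw [← hpre (ZMod.toCircle k)]
        exact (hmp _).setIntegral_preimage_emb (hemb _) v _
      simp [this]
    have h2 : ∫ _ in ball (0 : ℂ) r, (n * (v c - δ) : ℝ)
        ≤ ∫ w in ball (0 : ℂ) r, rotationSum v c n w := by
      refine setIntegral_mono_on (integrableOn_const (by finiteness)) ?_ measurableSet_ball
        fun w hw => h w (ball_subset_closedBall hw)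
      unfold rotationSum
      exact integrable_finsetSum _ fun k _ => hi _
    rw [e, setIntegral_const, smul_eq_mul, hvol] at h2
    have : (n : ℝ) * ((v c - δ) * volume.real (ball c r)) ≤ n * ∫ z in ball c r, v z := by
      linarith
    exact le_of_mul_le_mul_left this hn0
  have hlim : Tendsto (fun δ : ℝ => (v c - δ) * volume.real (ball c r)) (𝓝[>] 0)
      (𝓝 ((v c - 0) * volume.real (ball c r))) :=
    (Continuous.tendsto (by fun_prop) 0).mono_left nhdsWithin_le_nhds
  rw [sub_zero] at hlim
  exact le_of_tendsto hlim (eventually_mem_nhdsWithin.mono key)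

lemma erealBallAvg_coe {X : Type*} [NormedAddCommGroup X] [MeasureSpace X] {v : X → ℝ} {c : X}
    {r : ℝ} (hv : IntegrableOn v (ball c r)) (h0 : volume (ball c r) ≠ 0) :
    erealBallAvg (fun z => (v z : EReal)) c r
      = (((∫ z in ball c r, v z) / volume.real (ball c r) : ℝ) : EReal) := by
  have e1 : ∀ t : ℝ, erealToENNReal (t : EReal) = ENNReal.ofReal t := fun t => by
    simp [erealToENNReal]
  have e2 : ∀ t : ℝ, erealToENNReal (-(t : EReal)) = ENNReal.ofReal (-t) := fun t => by
    rw [← EReal.coe_neg, e1]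
  have f1 := hv.lintegral_lt_top.ne
  have f2 : ∫⁻ z in ball c r, ENNReal.ofReal (-v z) ≠ ⊤ := hv.neg.lintegral_lt_top.ne
  have coe : ∀ t : ℝ≥0∞, t ≠ ⊤ → (t : EReal) = ((t.toReal : ℝ) : EReal) := fun t ht =>
    (EReal.coe_toReal (by simpa using ht) (by simp)).symm.trans (by simp)
  simp only [erealBallAvg, e1, e2]
  rw [coe _ (ENNReal.div_ne_top f1 h0), coe _ (ENNReal.div_ne_top f2 h0), ← EReal.coe_sub,
    integral_eq_lintegral_pos_part_sub_lintegral_neg_part hv, ENNReal.toReal_div,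
    ENNReal.toReal_div, sub_div]
  rfl

lemma submeanOn_of_fourPoint {v : ℂ → ℝ} {s : Set ℂ} (hv : ContinuousOn v s)
    (hL : ∀ z ∈ s, FourPointLaplacianNonneg v z) :
    SubmeanOn (fun w => (v w : EReal)) s := by
  refine fun c _ => ⟨1, one_pos, fun r hr _ hsub => ?_⟩
  have hc := hv.mono hsub
  have hvol : 0 < volume (ball c r) := measure_ball_pos _ _ hr
  have hvol' : 0 < volume.real (ball c r) := ENNReal.toReal_pos hvol.ne' (by finiteness)
  rw [erealBallAvg_coe ((hc.integrableOn_compact (isCompact_closedBall c r)).mono_set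
    ball_subset_closedBall) hvol.ne', EReal.coe_le_coe_iff,
    le_div_iff₀ hvol']
  exact mul_volume_le_setIntegral_ball hc fun z hz => hL z (hsub (ball_subset_closedBall hz))

lemma IsLocalDefiningFunction.of_le {F : Type*} [NormedAddCommGroup F] [NormedSpace ℝ F]
    {Ω V : Set F} {k l : ℕ∞} {p : F} {ρ : F → ℝ} (h : IsLocalDefiningFunction Ω l p V ρ)
    (hkl : k ≤ l) : IsLocalDefiningFunction Ω k p V ρ :=
  ⟨h.1, h.2.1, h.2.2.1.of_le (by exact_mod_cast hkl), h.2.2.2⟩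

section LocalGeometry

variable {F : Type*} [NormedAddCommGroup F]

lemma infDist_frontier_le_dist [NormedSpace ℝ F] {Ω : Set F} {x y : F} (hx : x ∈ Ω)
    (hy : y ∉ Ω) : infDist x (frontier Ω) ≤ dist x y := by
  obtain ⟨z, hz, hzf⟩ : (segment ℝ x y ∩ frontier Ω).Nonempty := by
    by_contra! hne
    have hmiss : ∀ z ∈ segment ℝ x y, z ∉ frontier Ω := fun z hz hzf =>
      (hne ▸ (⟨hz, hzf⟩ : z ∈ segment ℝ x y ∩ frontier Ω) : z ∈ (∅ : Set F))
    have hsub : segment ℝ x y ⊆ interior Ω ∪ (closure Ω)ᶜ := fun z hz => by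
      by_contra h
      simp only [mem_union, mem_compl_iff, not_or, not_not] at h
      exact hmiss z hz ⟨h.2, h.1⟩
    obtain ⟨z, -, hz1, hz2⟩ := (convex_segment x y).isPreconnected _ _ isOpen_interior
      isClosed_closure.isOpen_compl hsub
      ⟨x, left_mem_segment ℝ x y, by
        by_contra h
        exact hmiss x (left_mem_segment ℝ x y) ⟨subset_closure hx, h⟩⟩
      ⟨y, right_mem_segment ℝ x y, fun h =>
        hmiss y (right_mem_segment ℝ x y) ⟨h, fun h' => hy (interior_subset h')⟩⟩
    exact hz2 (subset_closure (interior_subset hz1))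
  refine (infDist_le_dist_of_mem hzf).trans ?_
  linarith [dist_add_dist_of_mem_segment hz, dist_nonneg (x := z) (y := y)]

/-- Second-order Taylor expansion. -/
lemma ContDiffAt.isLittleO_taylor_two [NormedSpace ℝ F] {ρ : F → ℝ} {q : F}
    (hρ : ContDiffAt ℝ 2 ρ q) :
    (fun h => ρ (q + h) - ρ q - fderiv ℝ ρ q h - fderiv ℝ (fderiv ℝ ρ) q h h / 2)
      =o[𝓝 0] fun h => ‖h‖ ^ 2 := by
  set D := fderiv ℝ (fderiv ℝ ρ) q
  have hsymm : ∀ v w, D v w = D w v := hρ.isSymmSndFDerivAt (by simp)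
  have hD : HasFDerivAt (fderiv ℝ ρ) D q :=
    ((hρ.fderiv_right (m := 1) (by norm_num)).differentiableAt (by norm_num)).hasFDerivAt
  have hdiff : ∀ᶠ z in 𝓝 q, DifferentiableAt ℝ ρ z :=
    (hρ.eventually (by simp)).mono fun z hz => hz.differentiableAt (by norm_num)
  have htrans : Tendsto (fun h => q + h) (𝓝 0) (𝓝 q) := by
    simpa using (continuous_const_add q).tendsto 0
  rw [Asymptotics.isLittleO_iff]
  intro ε hε
  have hlin := (hasFDerivAt_iff_isLittleO_nhds_zero.1 hD).bound hε
  obtain ⟨δ, hδ, hball⟩ := Metric.eventually_nhds_iff_ball.1 (hlin.and (htrans.eventually hdiff))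
  refine Metric.eventually_nhds_iff_ball.2 ⟨δ, hδ, fun h hh => ?_⟩
  rw [mem_ball_zero_iff] at hh
  set G : F → ℝ := fun k => ρ (q + k) - fderiv ℝ ρ q k - D k k / 2
  have hG : ∀ k ∈ closedBall (0 : F) ‖h‖,
      HasFDerivWithinAt G (fderiv ℝ ρ (q + k) - fderiv ℝ ρ q - D k) (closedBall 0 ‖h‖) k := by
    intro k hk
    have hk' : k ∈ ball (0 : F) δ := by
      rw [mem_closedBall_zero_iff] at hk
      exact mem_ball_zero_iff.2 (hk.trans_lt hh)
    have h1 : HasFDerivAt (fun k => ρ (q + k)) (fderiv ℝ ρ (q + k)) k := by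
      exact (hball k hk').2.hasFDerivAt.comp k ((hasFDerivAt_id k).const_add q)
    have h2 : HasFDerivAt (fun k => D k k / 2) (D k) k := by
      have := (D.hasFDerivAt (x := k)).clm_apply (hasFDerivAt_id k)
      have h3 := this.const_smul (1 / 2 : ℝ)
      refine (h3.congr_of_eventuallyEq (.of_forall fun y => ?_)).congr_fderiv ?_
      · simp; ring
      · ext v
        simp [hsymm v k]
        ring
    exact ((h1.sub (fderiv ℝ ρ q).hasFDerivAt).sub h2).hasFDerivWithinAt
  have := (convex_closedBall (0 : F) ‖h‖).norm_image_sub_le_of_norm_hasFDerivWithin_le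
    (C := ε * ‖h‖) hG (fun k hk => by
      rw [mem_closedBall_zero_iff] at hk
      refine ((hball k (mem_ball_zero_iff.2 (hk.trans_lt hh))).1).trans ?_
      gcongr)
    (mem_closedBall_self (norm_nonneg h)) (mem_closedBall_zero_iff.2 le_rfl)
  simp only [G, sub_zero, add_zero, map_zero, zero_div] at this
  rw [norm_pow, norm_norm, pow_two, ← mul_assoc]
  rwa [show ρ (q + h) - ρ q - fderiv ℝ ρ q h - D h h / 2
    = ρ (q + h) - fderiv ℝ ρ q h - D h h / 2 - ρ q by ring]

lemma fderiv_fderiv_apply [NormedSpace ℝ F] {ρ : F → ℝ} {q : F} (hρ : ContDiffAt ℝ 2 ρ q)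
    (X Y : F) : fderiv ℝ (fun z => fderiv ℝ ρ z X) q Y = fderiv ℝ (fderiv ℝ ρ) q Y X := by
  have h : DifferentiableAt ℝ (fderiv ℝ ρ) q :=
    (hρ.fderiv_right (m := 1) (by norm_num)).differentiableAt (by norm_num)
  rw [fderiv_clm_apply h (differentiableAt_const X)]
  simp


lemma norm_sub_sq_re_inner [InnerProductSpace ℂ F] (a b : F) :
    ‖a - b‖ ^ 2 = ‖a‖ ^ 2 - 2 * (inner ℂ a b).re + ‖b‖ ^ 2 := by
  simpa using norm_sub_sq (𝕜 := ℂ) a b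

variable [InnerProductSpace ℂ F] [NormedSpace ℝ F] [IsScalarTower ℝ ℂ F]

lemma real_smul_eq_complex_smul (r : ℝ) (v : F) : r • v = (r : ℂ) • v := by
  rw [← Complex.coe_algebraMap, algebraMap_smul]

/-- At a nearest boundary point, the differential of a defining function is a negative multiple of
the inner product with the displacement. -/
lemma exists_fderiv_eq_neg_mul_inner {Ω V : Set F} {ρ : F → ℝ} {k : ℕ∞} (hk : 1 ≤ k) {x q : F}
    (hopen : IsOpen Ω) (hx : x ∈ Ω)
    (hq : q ∈ frontier Ω) (hd : dist x q = infDist x (frontier Ω))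
    (hρ : IsLocalDefiningFunction Ω k q V ρ) :
    ∃ c > 0, ∀ v, fderiv ℝ ρ q v = -c * (inner ℂ (x - q) v).re := by
  obtain ⟨hV, hqV, hC, hne, hneg, hzero⟩ := hρ
  have hqΩ : q ∉ Ω := by rw [hopen.frontier_eq] at hq; exact hq.2
  have hρq : ρ q = 0 := (hzero.subset ⟨hq, hqV⟩).2
  have hdiff : DifferentiableAt ℝ ρ q :=
    (hC.contDiffAt (hV.mem_nhds hqV)).differentiableAt (by
      have : (1 : WithTop ℕ∞) ≤ k := by exact_mod_cast hk
      intro h; rw [h] at this; simp at this)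
  have hL := hne q ⟨hqV, hq⟩
  set N := x - q
  set L := fderiv ℝ ρ q
  have hN : N ≠ 0 := sub_ne_zero.2 fun h => hqΩ (h ▸ hx)
  have hNpos : 0 < ‖N‖ ^ 2 := by have := norm_pos_iff.2 hN; positivity
  have hNN : (inner ℂ N N).re = ‖N‖ ^ 2 := by
    simpa using (inner_self_eq_norm_sq (𝕜 := ℂ) N)
  have hsmul : ∀ (v : F) (s : ℝ), (inner ℂ N (s • v)).re = s * (inner ℂ N v).re := by
    intro v s
    rw [real_smul_eq_complex_smul, inner_smul_right, Complex.re_ofReal_mul]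
  have hnonpos : ∀ v, 0 < (inner ℂ N v).re → L v ≤ 0 := by
    intro v hv
    have hder : HasDerivAt (fun s : ℝ => ρ (q + s • v)) (L v) 0 := by
      have h1 : HasDerivAt (fun s : ℝ => q + s • v) v 0 := by
        simpa using ((hasDerivAt_id (0 : ℝ)).smul_const v).const_add q
      have h2 : HasFDerivAt ρ L (q + (0 : ℝ) • v) := by simpa using hdiff.hasFDerivAt
      exact h2.comp_hasDerivAt 0 h1
    refine le_of_tendsto hder.tendsto_slope_zero_right ?_
    have hcont : Continuous fun s : ℝ => q + s • v := by fun_prop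
    have hVev : ∀ᶠ s in 𝓝[>] (0 : ℝ), q + s • v ∈ V :=
      (hcont.continuousAt.eventually_mem (by simpa using hV.mem_nhds hqV)).filter_mono
        nhdsWithin_le_nhds
    have hsmall : ∀ᶠ s in 𝓝[>] (0 : ℝ), s * ‖v‖ ^ 2 < 2 * (inner ℂ N v).re :=
      ((show Continuous fun s : ℝ => s * ‖v‖ ^ 2 by fun_prop).continuousAt.eventually_lt
        (continuousAt_const (y := 2 * (inner ℂ N v).re)) (by simpa using hv)).filter_mono
        nhdsWithin_le_nhds
    filter_upwards [hVev, hsmall, self_mem_nhdsWithin] with s hsV hs hs0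
    rw [mem_Ioi] at hs0
    have hmem : q + s • v ∈ Ω := by
      by_contra hmem
      have h1 := infDist_frontier_le_dist hx hmem
      rw [← hd, dist_eq_norm, dist_eq_norm, show x - (q + s • v) = N - s • v by
        simp only [N]; abel] at h1
      have h2 := norm_sub_sq_re_inner N (s • v)
      rw [hsmul, norm_smul, Real.norm_eq_abs, mul_pow, sq_abs] at h2
      have h3 : ‖N‖ ^ 2 ≤ ‖N - s • v‖ ^ 2 := by gcongr
      nlinarith
    have hlt : ρ (q + s • v) < 0 := (hneg.subset ⟨hmem, hsV⟩).2
    simp only [zero_add, zero_smul, add_zero, hρq, sub_zero, smul_eq_mul]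
    exact mul_nonpos_of_nonneg_of_nonpos (inv_nonneg.2 hs0.le) hlt.le
  have horth_le : ∀ v, (inner ℂ N v).re = 0 → L v ≤ 0 := by
    intro v hv
    have hlim : Tendsto (fun s : ℝ => L v + s * L N) (𝓝[>] 0) (𝓝 (L v + 0 * L N)) :=
      (Continuous.tendsto (by fun_prop) 0).mono_left nhdsWithin_le_nhds
    rw [zero_mul, add_zero] at hlim
    refine le_of_tendsto hlim (eventually_mem_nhdsWithin.mono fun s (hs : 0 < s) => ?_)
    have := hnonpos (v + s • N) (by
      rw [inner_add_right, Complex.add_re, hsmul, hv, hNN]; positivity)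
    simpa using this
  have horth : ∀ v, (inner ℂ N v).re = 0 → L v = 0 := fun v hv =>
    le_antisymm (horth_le v hv) (by
      have := horth_le (-v) (by rw [inner_neg_right, Complex.neg_re, hv, neg_zero])
      rw [map_neg] at this
      linarith)
  have hform : ∀ v, L v = -(-L N / ‖N‖ ^ 2) * (inner ℂ N v).re := by
    intro v
    have := horth (v - ((inner ℂ N v).re / ‖N‖ ^ 2) • N) (by
      rw [inner_sub_right, Complex.sub_re, hsmul, hNN]; field_simp; ring)
    rw [map_sub, map_smul, smul_eq_mul] at this
    linear_combination this
  refine ⟨-L N / ‖N‖ ^ 2, ?_, hform⟩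
  have hLN : L N ≤ 0 := hnonpos N (by rw [hNN]; exact hNpos)
  have hLN' : L N ≠ 0 := fun h => hL (by
    ext v
    simp [hform v, h])
  exact div_pos (neg_pos.2 (lt_of_le_of_ne hLN hLN')) hNpos

/-- Points of `Ω` close to a boundary point have a unique nearest boundary point. -/
lemma exists_ball_inter_medialAxis_eq_empty {Ω V : Set F} {ρ : F → ℝ} {p : F} (hopen : IsOpen Ω)
    (hp : p ∈ frontier Ω) (hρ : IsLocalDefiningFunction Ω 2 p V ρ) :
    ∃ δ > 0, ball p δ ∩ medialAxis Ω = ∅ := by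
  obtain ⟨hV, hpV, hC, hne, hneg, hzero⟩ := id hρ
  have hCp : ContDiffAt ℝ 2 ρ p := hC.contDiffAt (hV.mem_nhds hpV)
  have hC1 : ContDiffAt ℝ 1 (fderiv ℝ ρ) p := hCp.fderiv_right (by norm_num)
  obtain ⟨K, s, hs, hK⟩ := hC1.exists_lipschitzOnWith
  have hm : 0 < ‖fderiv ℝ ρ p‖ := norm_pos_iff.2 (hne p ⟨hpV, hp⟩)
  set m := ‖fderiv ℝ ρ p‖ / 2
  have hm' : 0 < m := by positivity
  have hev : ∀ᶠ z in 𝓝 p, m < ‖fderiv ℝ ρ z‖ :=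
    continuousAt_const.eventually_lt hC1.continuousAt.norm (half_lt_self hm)
  obtain ⟨r, hr, hball⟩ := Metric.eventually_nhds_iff_ball.1
    (hev.and ((hV.eventually_mem hpV).and hs))
  refine ⟨min (r / 2) (m / (2 * K + 1)), by positivity, ?_⟩
  rw [eq_empty_iff_forall_notMem]
  rintro z ⟨hzp, hzΩ, q₁, hq₁, q₂, hq₂, hq, hd₁, hd₂⟩
  rw [mem_ball, lt_min_iff] at hzp
  have hdist : infDist z (frontier Ω) ≤ dist z p := infDist_le_dist_of_mem hp
  have hqball : ∀ q, dist z q = infDist z (frontier Ω) → q ∈ ball p r := fun q hdq => by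
    rw [mem_ball]
    have := dist_triangle_left q p z
    linarith
  have hb₁ := hqball q₁ hd₁
  have hb₂ := hqball q₂ hd₂
  obtain ⟨c, hc, hform⟩ := exists_fderiv_eq_neg_mul_inner (by norm_num) hopen hzΩ hq₁ hd₁
    ⟨hV, (hball q₁ hb₁).2.1, hC, hne, hneg, hzero⟩
  have hρ₁ : ρ q₁ = 0 := (hzero.subset ⟨hq₁, (hball q₁ hb₁).2.1⟩).2
  have hρ₂ : ρ q₂ = 0 := (hzero.subset ⟨hq₂, (hball q₂ hb₂).2.1⟩).2
  have hmc : m ≤ c * ‖z - q₁‖ := by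
    refine (hball q₁ hb₁).1.le.trans (ContinuousLinearMap.opNorm_le_bound _ (by positivity) ?_)
    intro v
    rw [hform, norm_mul, norm_neg, Real.norm_of_nonneg hc.le, mul_assoc]
    gcongr
    exact (Complex.abs_re_le_norm _).trans (norm_inner_le_norm _ _)
  have hquad : ‖ρ q₂ - ρ q₁ - fderiv ℝ ρ q₁ (q₂ - q₁)‖ ≤ K * ‖q₂ - q₁‖ * ‖q₂ - q₁‖ := by
    have hseg : segment ℝ q₁ q₂ ⊆ ball p r := (convex_ball p r).segment_subset hb₁ hb₂
    refine (convex_segment q₁ q₂).norm_image_sub_le_of_norm_fderiv_le' (𝕜 := ℝ)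
      (fun y hy => ?_) (fun y hy => ?_) (left_mem_segment ℝ _ _) (right_mem_segment ℝ _ _)
    · exact (hC.contDiffAt (hV.mem_nhds (hball y (hseg hy)).2.1)).differentiableAt (by norm_num)
    · have h1 := hK.norm_sub_le (hball y (hseg hy)).2.2 (hball q₁ hb₁).2.2
      refine h1.trans ?_
      have h2 := dist_add_dist_of_mem_segment hy
      rw [dist_eq_norm', dist_eq_norm' q₁ q₂] at h2
      have := dist_nonneg (x := y) (y := q₂)
      gcongr
      linarith
  rw [hρ₁, hρ₂, sub_zero, zero_sub, norm_neg, hform, norm_mul, norm_neg,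
    Real.norm_of_nonneg hc.le] at hquad
  have hinner : (inner ℂ (z - q₁) (q₂ - q₁)).re = ‖q₂ - q₁‖ ^ 2 / 2 := by
    have h1 := norm_sub_sq_re_inner (z - q₁) (q₂ - q₁)
    rw [sub_sub_sub_cancel_right, ← dist_eq_norm z q₂, ← dist_eq_norm z q₁, hd₁, hd₂] at h1
    linarith
  have hpos : 0 < ‖q₂ - q₁‖ ^ 2 := by
    have := norm_pos_iff.2 (sub_ne_zero.2 hq.symm)
    positivity
  rw [hinner, Real.norm_of_nonneg (by positivity)] at hquad
  have hcK : c ≤ 2 * K := by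
    by_contra! h
    nlinarith
  have hz : ‖z - q₁‖ < m / (2 * K + 1) := by
    rw [← dist_eq_norm, hd₁]; linarith
  rw [lt_div_iff₀ (by positivity)] at hz
  nlinarith [norm_nonneg (z - q₁), K.2]

/-- The exponent `λ w + μ w² + ε |w|²`. -/
def quadExponent (lam mu : ℂ) (ε : ℝ) (w : ℂ) : ℂ :=
  lam * w + mu * w ^ 2 + (ε * ‖w‖ ^ 2 : ℝ)

lemma quadExponent_eq (lam mu : ℂ) (ε : ℝ) (w : ℂ) :
    quadExponent lam mu ε w = w * (lam + mu * w + ε * (starRingEnd ℂ) w) := by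
  have : ((‖w‖ : ℂ)) ^ 2 = w * (starRingEnd ℂ) w := (Complex.mul_conj' w).symm
  simp only [quadExponent, Complex.ofReal_mul, Complex.ofReal_pow, this]
  ring

lemma isBigO_quadExponent (lam mu : ℂ) (ε : ℝ) :
    quadExponent lam mu ε =O[𝓝 0] fun w => w := by
  have h : (fun w : ℂ => lam + mu * w + ε * (starRingEnd ℂ) w) =O[𝓝 0] fun _ => (1 : ℂ) :=
    (show Continuous fun w : ℂ => lam + mu * w + ε * (starRingEnd ℂ) w by
      fun_prop).continuousAt.isBigO_one ℂ
  simpa [funext (quadExponent_eq lam mu ε)] using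
    (Asymptotics.isBigO_refl (fun w : ℂ => w) (𝓝 0)).mul h

lemma isLittleO_one_add_sub_exp_quadExponent (lam mu : ℂ) (ε : ℝ) :
    (fun w => 1 + lam * w - Complex.exp (quadExponent lam mu ε w)
      + ((mu + lam ^ 2 / 2) * w ^ 2 + (ε * ‖w‖ ^ 2 : ℝ))) =o[𝓝 0] fun w : ℂ => ‖w‖ ^ 2 := by
  have hO := isBigO_quadExponent lam mu ε
  have h0 : Tendsto (quadExponent lam mu ε) (𝓝 0) (𝓝 0) := hO.trans_tendsto tendsto_id
  have hexp : (fun w => Complex.exp (quadExponent lam mu ε w)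
      - ∑ i ∈ Finset.range 3, quadExponent lam mu ε w ^ i / (i.factorial : ℂ))
      =o[𝓝 0] fun w => w ^ 2 :=
    ((Complex.exp_sub_sum_range_succ_isLittleO_pow 2).comp_tendsto h0).trans_isBigO (hO.pow 2)
  have hsq : (fun w => w ^ 2 * (((lam + mu * w + ε * (starRingEnd ℂ) w) ^ 2 - lam ^ 2) / 2))
      =o[𝓝 0] fun w : ℂ => w ^ 2 * 1 := by
    refine (Asymptotics.isBigO_refl _ _).mul_isLittleO ((Asymptotics.isLittleO_one_iff ℂ).2 ?_)
    have : Continuous fun w : ℂ => ((lam + mu * w + ε * (starRingEnd ℂ) w) ^ 2 - lam ^ 2) / 2 := by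
      fun_prop
    simpa using this.tendsto 0
  simp only [mul_one] at hsq
  have hnorm : (fun w : ℂ => w ^ 2) =O[𝓝 0] fun w : ℂ => ‖w‖ ^ 2 :=
    Asymptotics.isBigO_of_le _ fun w => by simp
  refine ((hexp.neg_left.sub hsq).trans_isBigO hnorm).congr_left fun w => ?_
  have e : quadExponent lam mu ε w ^ 2 = w ^ 2 * (lam + mu * w + ε * (starRingEnd ℂ) w) ^ 2 := by
    rw [quadExponent_eq, mul_pow]
  simp only [Finset.sum_range_succ, Finset.sum_range_zero, Nat.factorial, pow_zero, pow_one]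
  rw [mul_div_assoc', mul_sub, ← e]
  push_cast
  simp only [quadExponent]
  push_cast
  ring

/-- The real quadratic form along a complex line, split into its trace part and the real part of
a holomorphic polynomial. -/
lemma bilin_smul_smul (D : F →L[ℝ] F →L[ℝ] ℝ) (X : F)
    (hsymm : D X (Complex.I • X) = D (Complex.I • X) X) (w : ℂ) :
    D (w • X) (w • X) = (D X X + D (Complex.I • X) (Complex.I • X)) / 2 * ‖w‖ ^ 2
      + (D X X - D (Complex.I • X) (Complex.I • X)) / 2 * (w ^ 2).re
      + D (Complex.I • X) X * (w ^ 2).im := by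
  have e : w • X = w.re • X + w.im • (Complex.I • X) := by
    rw [real_smul_eq_complex_smul, real_smul_eq_complex_smul, smul_smul, ← add_smul,
      Complex.re_add_im]
  have hn : ‖w‖ ^ 2 = w.re ^ 2 + w.im ^ 2 := by
    rw [← Complex.normSq_eq_norm_sq, Complex.normSq_apply]; ring
  rw [e, hn, pow_two w, Complex.mul_re, Complex.mul_im]
  simp only [map_add, map_smul, add_apply, smul_apply, smul_eq_mul, hsymm]
  ring

/-- Pushing the nearest boundary point along a suitable curve keeps it outside `{ρ < 0}`. -/
lemma exists_eventually_nonneg_along_curve {ρ : F → ℝ} {q N : F} {c : ℝ}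
    (hρ : ContDiffAt ℝ 2 ρ q) (hρq : ρ q = 0) (hN : N ≠ 0) (hc : 0 < c)
    (hform : ∀ v, fderiv ℝ ρ q v = -c * (inner ℂ N v).re)
    (hlevi : ∀ X : F, fderiv ℝ ρ q X = 0 → fderiv ℝ ρ q (Complex.I • X) = 0 →
      0 ≤ fderiv ℝ (fun z => fderiv ℝ ρ z X) q X
          + fderiv ℝ (fun z => fderiv ℝ ρ z (Complex.I • X)) q (Complex.I • X))
    (b : F) {ε : ℝ} (hε : 0 < ε) :
    ∃ lam mu : ℂ, ∀ᶠ w in 𝓝 (0 : ℂ),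
      0 ≤ ρ (q + (N + w • b - Complex.exp (quadExponent lam mu ε w) • N)) := by
  have hNpos : 0 < ‖N‖ ^ 2 := by have := norm_pos_iff.2 hN; positivity
  have hNC : (inner ℂ N N : ℂ) = (‖N‖ ^ 2 : ℝ) := by
    exact_mod_cast inner_self_eq_norm_sq_to_K (𝕜 := ℂ) N
  set D := fderiv ℝ (fderiv ℝ ρ) q
  have hsymm : ∀ v w, D v w = D w v := hρ.isSymmSndFDerivAt (by simp)
  set lam : ℂ := inner ℂ N b / (‖N‖ ^ 2 : ℝ)
  set X : F := b - lam • N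
  have hNX : inner ℂ N X = (0 : ℂ) := by
    have : ((‖N‖ ^ 2 : ℝ) : ℂ) ≠ 0 := by exact_mod_cast hNpos.ne'
    rw [inner_sub_right, inner_smul_right, hNC, div_mul_cancel₀ _ this, sub_self]
  have hLX : ∀ w : ℂ, fderiv ℝ ρ q (w • X) = 0 := fun w => by
    rw [hform, inner_smul_right, hNX]; simp
  have hlX := hlevi X (by simpa using hLX 1) (hLX _)
  rw [fderiv_fderiv_apply hρ, fderiv_fderiv_apply hρ] at hlX
  set m := c * ‖N‖ ^ 2
  have hm : 0 < m := by positivity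
  have hLN : ∀ z : ℂ, fderiv ℝ ρ q (z • N) = -m * z.re := fun z => by
    rw [hform, inner_smul_right, hNC, Complex.re_mul_ofReal]
    ring
  set A := D X X - D (Complex.I • X) (Complex.I • X)
  set B := D (Complex.I • X) X
  set κ : ℂ := ⟨-A / 4 / m, B / 2 / m⟩
  refine ⟨lam, κ - lam ^ 2 / 2, ?_⟩
  set e : ℂ → ℂ := fun w => 1 + lam * w - Complex.exp (quadExponent lam (κ - lam ^ 2 / 2) ε w)
  set R : ℂ → ℂ := fun w => e w + (κ * w ^ 2 + (ε * ‖w‖ ^ 2 : ℝ))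
  have hR : R =o[𝓝 0] fun w : ℂ => ‖w‖ ^ 2 := by
    refine (isLittleO_one_add_sub_exp_quadExponent lam (κ - lam ^ 2 / 2) ε).congr_left fun w => ?_
    simp only [R, e]
    ring
  have hsq : (fun w : ℂ => ‖w‖ ^ 2) =o[𝓝 0] fun w : ℂ => ‖w‖ :=
    (Asymptotics.isLittleO_pow_id (𝕜 := ℝ) one_lt_two).comp_tendsto (tendsto_norm_zero (E := ℂ))
  have he : e =o[𝓝 0] fun w : ℂ => ‖w‖ := by
    have h1 : (fun w : ℂ => κ * w ^ 2 + (ε * ‖w‖ ^ 2 : ℝ)) =O[𝓝 0] fun w : ℂ => ‖w‖ ^ 2 := by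
      refine Asymptotics.IsBigO.of_bound (‖κ‖ + ε) (.of_forall fun w => ?_)
      refine (norm_add_le _ _).trans ?_
      rw [norm_mul, norm_pow, Complex.norm_real, norm_mul, Real.norm_of_nonneg hε.le, add_mul,
        Real.norm_of_nonneg (sq_nonneg ‖w‖)]
    refine ((hR.isBigO.sub h1).trans_isLittleO hsq).congr_left fun w => ?_
    simp only [R]; ring
  set h : ℂ → F := fun w => N + w • b - Complex.exp (quadExponent lam (κ - lam ^ 2 / 2) ε w) • N
  have hh : ∀ w, h w = w • X + e w • N := fun w => by
    simp only [h, X, e]; module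
  have heN : (fun w => e w • N) =o[𝓝 0] fun w : ℂ => ‖w‖ := by
    refine Asymptotics.IsBigO.trans_isLittleO ?_ he
    exact Asymptotics.IsBigO.of_bound ‖N‖ (.of_forall fun w => by rw [norm_smul, mul_comm])
  have hwX : (fun w : ℂ => w • X) =O[𝓝 0] fun w : ℂ => ‖w‖ :=
    Asymptotics.IsBigO.of_bound ‖X‖ (.of_forall fun w => by rw [norm_smul, mul_comm, norm_norm])
  have hhO : h =O[𝓝 0] fun w : ℂ => ‖w‖ :=
    (hwX.add heN.isBigO).congr_left fun w => (hh w).symm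
  have hh0 : Tendsto h (𝓝 0) (𝓝 0) := hhO.trans_tendsto (tendsto_norm_zero (E := ℂ))
  have hT : (fun w => ρ (q + h w) - ρ q - fderiv ℝ ρ q (h w) - D (h w) (h w) / 2)
      =o[𝓝 0] fun w : ℂ => ‖w‖ ^ 2 :=
    (hρ.isLittleO_taylor_two.comp_tendsto hh0).trans_isBigO (hhO.norm_left.pow 2)
  have hDD : (fun w => D (h w) (h w) - D (w • X) (w • X)) =o[𝓝 0] fun w : ℂ => ‖w‖ ^ 2 := by
    have h1 : (fun w => D (h w) (h w) - D (w • X) (w • X))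
        =O[𝓝 0] fun w => ‖e w • N‖ * (‖h w‖ + ‖w • X‖) := by
      refine Asymptotics.IsBigO.of_bound ‖D‖ (.of_forall fun w => ?_)
      have e1 : D (h w) (h w) - D (w • X) (w • X)
          = D (e w • N) (h w) + D (e w • N) (w • X) := by
        rw [hsymm (e w • N) (w • X), hh w]
        simp only [map_add, add_apply]
        ring
      rw [e1, Real.norm_of_nonneg (show 0 ≤ ‖e w • N‖ * (‖h w‖ + ‖w • X‖) by positivity)]
      refine (norm_add_le _ _).trans ?_
      have := D.le_opNorm₂ (e w • N) (h w)
      have := D.le_opNorm₂ (e w • N) (w • X)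
      linarith
    refine h1.trans_isLittleO ?_
    simp only [pow_two]
    exact heN.norm_left.mul_isBigO (hhO.norm_left.add hwX.norm_left)
  have hRre : (fun w => m * (R w).re) =o[𝓝 0] fun w : ℂ => ‖w‖ ^ 2 := by
    refine Asymptotics.IsBigO.trans_isLittleO ?_ hR
    refine Asymptotics.IsBigO.of_bound m (.of_forall fun w => ?_)
    rw [norm_mul, Real.norm_of_nonneg hm.le]
    gcongr
    exact Complex.abs_re_le_norm _
  have htot := ((hT.add (hDD.const_mul_left (1 / 2))).sub hRre).bound
    (show 0 < m * ε by positivity)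
  filter_upwards [htot] with w hw
  rw [Real.norm_eq_abs, norm_pow, norm_norm] at hw
  have hw' := (abs_le.1 hw).1
  have hform1 : fderiv ℝ ρ q (h w) = -m * (e w).re := by
    rw [hh, map_add, hLX, hLN, zero_add]
  have hre : m * (R w).re = m * (e w).re + (-A / 4 * (w ^ 2).re - B / 2 * (w ^ 2).im)
      + m * ε * ‖w‖ ^ 2 := by
    simp only [R, Complex.add_re, Complex.mul_re, Complex.ofReal_re, κ]
    field_simp
    ring
  have hb := bilin_smul_smul D X (hsymm _ _) w
  have hpos : 0 ≤ (D X X + D (Complex.I • X) (Complex.I • X)) * ‖w‖ ^ 2 := by positivity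
  rw [hρq, hform1, hre, hb] at hw'
  linarith

/-- The function `-log d` has nonnegative lower four-point Laplacian along complex lines. -/
lemma fourPoint_negLog_infDist {Ω V : Set F} {ρ : F → ℝ} {x q : F} (hopen : IsOpen Ω) (hx : x ∈ Ω)
    (hq : q ∈ frontier Ω) (hd : dist x q = infDist x (frontier Ω))
    (hρ : IsLocalDefiningFunction Ω 2 q V ρ)
    (hlevi : ∀ X : F, fderiv ℝ ρ q X = 0 → fderiv ℝ ρ q (Complex.I • X) = 0 →
      0 ≤ fderiv ℝ (fun z => fderiv ℝ ρ z X) q X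
          + fderiv ℝ (fun z => fderiv ℝ ρ z (Complex.I • X)) q (Complex.I • X))
    {a b : F} {w₀ : ℂ} (hw₀ : a + w₀ • b = x) :
    FourPointLaplacianNonneg (fun w => -Real.log (infDist (a + w • b) (frontier Ω))) w₀ := by
  intro ε hε
  obtain ⟨c, hc, hform⟩ := exists_fderiv_eq_neg_mul_inner (by norm_num) hopen hx hq hd hρ
  obtain ⟨hV, hqV, hC, -, hneg, hzero⟩ := hρ
  have hqΩ : q ∉ Ω := by rw [hopen.frontier_eq] at hq; exact hq.2
  have hN : x - q ≠ 0 := sub_ne_zero.2 fun h => hqΩ (h ▸ hx)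
  obtain ⟨lam, mu, hev⟩ := exists_eventually_nonneg_along_curve
    (hC.contDiffAt (hV.mem_nhds hqV)) (hzero.subset ⟨hq, hqV⟩).2 hN hc hform hlevi b
    (show 0 < ε / 4 by positivity)
  have hcont : Continuous fun w : ℂ =>
      q + (x - q + w • b - Complex.exp (quadExponent lam mu (ε / 4) w) • (x - q)) := by
    unfold quadExponent
    fun_prop
  have hVev : ∀ᶠ w in 𝓝 (0 : ℂ),
      q + (x - q + w • b - Complex.exp (quadExponent lam mu (ε / 4) w) • (x - q)) ∈ V :=
    hcont.continuousAt.eventually_mem (by simpa [quadExponent] using hV.mem_nhds hqV)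
  have hΩev : ∀ᶠ w in 𝓝 (0 : ℂ), x + w • b ∈ Ω :=
    (show Continuous fun w : ℂ => x + w • b by fun_prop).continuousAt.eventually_mem
      (by simpa using hopen.mem_nhds hx)
  have hpos : ∀ z ∈ Ω, 0 < infDist z (frontier Ω) := fun z hz =>
    (isClosed_frontier.notMem_iff_infDist_pos ⟨q, hq⟩).1 fun h => by
      rw [hopen.frontier_eq] at h; exact h.2 hz
  have hlower : ∀ᶠ w in 𝓝 (0 : ℂ), -Real.log (infDist x (frontier Ω))
      - (lam * w + mu * w ^ 2).re - ε / 4 * ‖w‖ ^ 2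
        ≤ -Real.log (infDist (x + w • b) (frontier Ω)) := by
    filter_upwards [hev, hVev, hΩev] with w h1 h2 h3
    have hout : q + (x - q + w • b - Complex.exp (quadExponent lam mu (ε / 4) w) • (x - q)) ∉ Ω :=
      fun h => (hneg.subset ⟨h, h2⟩).2.not_ge h1
    have h4 := infDist_frontier_le_dist h3 hout
    rw [dist_eq_norm, show x + w • b - (q + (x - q + w • b
      - Complex.exp (quadExponent lam mu (ε / 4) w) • (x - q)))
      = Complex.exp (quadExponent lam mu (ε / 4) w) • (x - q) by abel, norm_smul, ← dist_eq_norm,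
      hd, Complex.norm_exp] at h4
    have h5 := Real.log_le_log (hpos _ h3) h4
    rw [Real.log_mul (Real.exp_ne_zero _) (hpos x hx).ne', Real.log_exp, quadExponent,
      Complex.add_re, Complex.ofReal_re] at h5
    linarith
  have ht : ∀ ζ : ℂ, Tendsto (fun w : ℂ => ζ * w) (𝓝 0) (𝓝 0) := fun ζ => by
    simpa using (show Continuous fun w : ℂ => ζ * w by fun_prop).tendsto 0
  filter_upwards [hlower, (ht (-1)).eventually hlower, (ht Complex.I).eventually hlower,
    (ht (-Complex.I)).eventually hlower] with w k1 k2 k3 k4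
  have epoint : ∀ u : ℂ, a + (w₀ + u) • b = x + u • b := fun u => by
    rw [← hw₀, add_smul, add_assoc]
  have hI : (Complex.I * w) ^ 2 = -w ^ 2 := by rw [mul_pow, Complex.I_sq]; ring
  simp only [neg_mul, one_mul, neg_sq, hI, norm_neg, norm_mul, Complex.norm_I, mul_neg,
    Complex.add_re, Complex.neg_re] at k1 k2 k3 k4
  simp only [sub_eq_add_neg w₀, epoint, hw₀]
  linarith

end LocalGeometry

/-- Theorem (statement 2): if `Ω ⊆ ℂⁿ` is a bounded domain with smooth boundary which is Levi
pseudoconvex, and `Σ` is the cut locus of `Ω`, then `z ↦ -log(d_{∂Ω}(z))` is plurisubharmonic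
on `Ω \ Σ`. -/
theorem negLogDist_psh_off_cutLocus (n : ℕ) (Ω : Set (EuclideanSpace ℂ (Fin n)))
    (hopen : IsOpen Ω) (hconn : IsConnected Ω) (hbdd : Bornology.IsBounded Ω)
    (hsmooth : HasCkBoundary Ω ⊤) (hlevi : LeviPseudoconvex Ω) :
    IsPlurisubharmonicOn
      (fun z => ((- Real.log (infDist z (frontier Ω)) : ℝ) : EReal))
      (Ω \ cutLocus Ω) := by
  have hsub : ∀ z ∈ Ω \ cutLocus Ω, z ∈ Ω := fun z hz => hz.1
  have hcont : ContinuousOn (fun z => -Real.log (infDist z (frontier Ω))) Ω := by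
    rcases (frontier Ω).eq_empty_or_nonempty with h | h
    · simp only [h, infDist_empty]
      exact continuousOn_const
    · refine ((continuous_infDist_pt _).continuousOn.log fun z hz => ?_).neg
      refine ((isClosed_frontier.notMem_iff_infDist_pos h).1 fun h' => ?_).ne'
      rw [hopen.frontier_eq] at h'
      exact h'.2 hz
  refine ⟨?_, ?_, fun z _ => EReal.coe_lt_top _, fun a b => ?_⟩
  · exact (continuous_coe_real_ereal.comp_continuousOn (hcont.mono hsub)).upperSemicontinuousOn
  · obtain ⟨z, hz⟩ : (Ω \ cutLocus Ω).Nonempty := by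
      rcases (frontier Ω).eq_empty_or_nonempty with h | ⟨p, hp⟩
      · obtain ⟨z, hz⟩ := hconn.nonempty
        refine ⟨z, hz, fun hcut => ?_⟩
        simp [cutLocus, medialAxis, h] at hcut
      · obtain ⟨V, ρ, hρ⟩ := hsmooth p hp
        obtain ⟨δ, hδ, hδM⟩ := exists_ball_inter_medialAxis_eq_empty hopen hp (hρ.of_le le_top)
        obtain ⟨z, hz, hzp⟩ := Metric.mem_closure_iff.1 (frontier_subset_closure hp) δ hδ
        refine ⟨z, hz, fun hcut => ?_⟩
        obtain ⟨y, hy⟩ := mem_closure_iff.1 hcut.1 _ isOpen_ball (mem_ball'.2 hzp)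
        exact hδM.subset hy
    exact fun h => EReal.coe_ne_bot _ (h z hz)
  · refine submeanOn_of_fourPoint (v := fun w => -Real.log (infDist (a + w • b) (frontier Ω)))
      (hcont.comp (by fun_prop) fun w hw => hw.1) fun w hw => ?_
    rcases (frontier Ω).eq_empty_or_nonempty with h | h
    · intro ε hε
      refine .of_forall fun w => ?_
      simp only [h, infDist_empty, Real.log_zero]
      have : 0 ≤ ε * ‖w‖ ^ 2 := by positivity
      linarith
    · obtain ⟨q, hq, hd⟩ := isClosed_frontier.exists_infDist_eq_dist h (a + w • b)
      obtain ⟨V, ρ, hρ⟩ := hsmooth q hq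
      exact fourPoint_negLog_infDist hopen hw.1 hq hd.symm (hρ.of_le le_top)
        (hlevi q hq V ρ (hρ.of_le le_top)) rfl

end
end

section
/- Let m > 2 and let Ω ⊊ ℝ^m be any domain. Then the function x ↦ (d_{∂Ω}(x))^{2-m} is subharmonic on Ω. -/
open MeasureTheory Metric Filter Topology Set
open scoped ENNReal

noncomputable section

variable {E : Type*} [NormedAddCommGroup E] [MeasureSpace E]

section MeanValue

open InnerProductSpace Module Laplacian
open scoped RealInnerProductSpace NNReal

section Paraboloid

variable {X : Type*} [PseudoMetricSpace X]

/-- The truncated paraboloid `(r² - d(z, x)²)₊ / 2`. -/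
def paraboloid (x : X) (r : ℝ) (z : X) : ℝ := (r ^ 2 - min (dist z x) r ^ 2) / 2

lemma lipschitzWith_paraboloid (x : X) (r : ℝ≥0) : LipschitzWith r (paraboloid x r) := by
  refine LipschitzWith.of_dist_le_mul fun z w => ?_
  have hmin : |min (dist z x) (r : ℝ) - min (dist w x) r| ≤ dist z w :=
    (abs_min_sub_min_le_max _ _ _ _).trans <| by
      simpa using abs_dist_sub_le z w x
  have hz : 0 ≤ min (dist z x) (r : ℝ) := le_min dist_nonneg r.2
  have hw : 0 ≤ min (dist w x) (r : ℝ) := le_min dist_nonneg r.2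
  have hz' := min_le_right (dist z x) (r : ℝ)
  have hw' := min_le_right (dist w x) (r : ℝ)
  have heq : paraboloid x r z - paraboloid x r w =
      -((min (dist z x) (r : ℝ) + min (dist w x) r) / 2 *
        (min (dist z x) (r : ℝ) - min (dist w x) r)) := by
    unfold paraboloid
    ring
  rw [Real.dist_eq, heq, abs_neg, abs_mul, abs_of_nonneg (by positivity)]
  exact mul_le_mul (by linarith) hmin (abs_nonneg _) r.2

lemma paraboloid_eq_zero {x z : X} {r : ℝ} (hz : z ∉ ball x r) : paraboloid x r z = 0 := by
  rw [paraboloid, min_eq_right (not_lt.1 hz)]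
  ring

end Paraboloid

variable {V : Type*} [NormedAddCommGroup V] [InnerProductSpace ℝ V]

/-- The gradient of a real power of the distance to `y`, away from `y`. -/
lemma hasFDerivAt_norm_sub_rpow (p : ℝ) {y z : V} (hz : z ≠ y) :
    HasFDerivAt (fun w => ‖w - y‖ ^ p) ((p * ‖z - y‖ ^ (p - 2)) • innerSL ℝ (z - y)) z := by
  have hpos : 0 < ‖z - y‖ := norm_pos_iff.2 (sub_ne_zero.2 hz)
  have hsq : HasFDerivAt (fun w : V => ‖w - y‖ ^ 2) (2 • innerSL ℝ (z - y)) z := by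
    simpa using ((hasFDerivAt_id z).sub_const y).norm_sq
  have hpow := hsq.rpow_const (p := p / 2) (Or.inl (by positivity))
  have hfun : (fun w => ‖w - y‖ ^ p) = fun w => (‖w - y‖ ^ 2) ^ (p / 2) := by
    ext w
    rw [← Real.rpow_natCast_mul (norm_nonneg _)]
    congr 1
    push_cast
    ring
  rw [hfun]
  refine hpow.congr_fderiv ?_
  rw [← Real.rpow_natCast_mul (norm_nonneg _), ← Nat.cast_smul_eq_nsmul ℝ, smul_smul]
  congr 1
  push_cast
  ring_nf

/-- The second derivative of a real power of the distance to `y`, away from `y`. -/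
lemma fderiv_fderiv_norm_sub_rpow_apply (p : ℝ) {y z : V} (hz : z ≠ y) (v : V) :
    fderiv ℝ (fderiv ℝ fun w => ‖w - y‖ ^ p) z v v =
      p * ‖z - y‖ ^ (p - 2) * ⟪v, v⟫ + p * (p - 2) * ‖z - y‖ ^ (p - 4) * ⟪z - y, v⟫ ^ 2 := by
  have hev : fderiv ℝ (fun w => ‖w - y‖ ^ p) =ᶠ[𝓝 z]
      fun w => (p * ‖w - y‖ ^ (p - 2)) • innerSL ℝ (w - y) := by
    filter_upwards [isOpen_ne.mem_nhds hz] with w hw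
    exact (hasFDerivAt_norm_sub_rpow p hw).fderiv
  have hlin : HasFDerivAt (fun w : V => innerSL ℝ (w - y)) (innerSL ℝ : V →L[ℝ] V →L[ℝ] ℝ) z := by
    simp only [map_sub]
    exact (innerSL ℝ : V →L[ℝ] V →L[ℝ] ℝ).hasFDerivAt.sub_const _
  have hsmul : HasFDerivAt (fun w => (p * ‖w - y‖ ^ (p - 2)) • innerSL ℝ (w - y)) _ z :=
    ((hasFDerivAt_norm_sub_rpow (p - 2) hz).const_mul p).smul hlin
  rw [hev.fderiv_eq, hsmul.fderiv]
  simp only [add_apply, smul_apply,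
    ContinuousLinearMap.smulRight_apply, innerSL_apply_apply, smul_eq_mul]
  ring_nf
  rfl

lemma laplacian_apply_eq_sum_fderiv [FiniteDimensional ℝ V] (f : V → ℝ) (z : V) :
    Δ f z = ∑ i, fderiv ℝ (fderiv ℝ f) z (stdOrthonormalBasis ℝ V i)
      (stdOrthonormalBasis ℝ V i) := by
  simp [laplacian_eq_iteratedFDeriv_stdOrthonormalBasis, iteratedFDeriv_two_apply]

/-- The Newtonian kernel with pole `y` is harmonic away from `y`. -/
theorem harmonicAt_norm_sub_rpow [FiniteDimensional ℝ V] {y z : V} (hz : z ≠ y) :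
    HarmonicAt (fun w => ‖w - y‖ ^ ((2 : ℝ) - finrank ℝ V)) z := by
  refine ⟨((contDiffAt_id.sub contDiffAt_const).norm ℝ (sub_ne_zero.2 hz)).rpow_const_of_ne
    (norm_ne_zero_iff.2 (sub_ne_zero.2 hz)), ?_⟩
  filter_upwards [isOpen_ne.mem_nhds hz] with w hw
  have hpos : 0 < ‖w - y‖ := norm_pos_iff.2 (sub_ne_zero.2 hw)
  set p : ℝ := 2 - finrank ℝ V with hp
  have hpow : ‖w - y‖ ^ (p - 4) * ‖w - y‖ ^ 2 = ‖w - y‖ ^ (p - 2) := by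
    rw [← Real.rpow_natCast, ← Real.rpow_add hpos]
    norm_num
    ring_nf
  simp only [laplacian_apply_eq_sum_fderiv, fderiv_fderiv_norm_sub_rpow_apply p hw,
    Finset.sum_add_distrib, ← Finset.mul_sum]
  have hsum := (stdOrthonormalBasis ℝ V).sum_sq_inner_left (w - y)
  simp only [hsum, real_inner_self_eq_norm_sq, OrthonormalBasis.norm_eq_one]
  simp only [one_pow, Finset.sum_const, Finset.card_univ, Fintype.card_fin, nsmul_eq_mul, mul_one,
    Pi.zero_apply]
  rw [mul_assoc (p * (p - 2)), hpow, hp]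
  ring

lemma lineDeriv_paraboloid_of_mem_ball {x z : V} {r : ℝ} (hz : z ∈ ball x r) (v : V) :
    lineDeriv ℝ (paraboloid x r) z v = -⟪z - x, v⟫ := by
  have hev : paraboloid x r =ᶠ[𝓝 z] fun w => (r ^ 2 - ‖w - x‖ ^ 2) / 2 := by
    filter_upwards [isOpen_ball.mem_nhds hz] with w hw
    rw [paraboloid, min_eq_left (mem_ball.1 hw).le, dist_eq_norm]
  have hsq : HasFDerivAt (fun w : V => ‖w - x‖ ^ 2) (2 • innerSL ℝ (z - x)) z := by
    simpa using ((hasFDerivAt_id z).sub_const x).norm_sq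
  have hd : HasFDerivAt (fun w : V => (r ^ 2 - ‖w - x‖ ^ 2) / 2) (-innerSL ℝ (z - x)) z := by
    refine ((hsq.const_sub (r ^ 2)).mul_const (2⁻¹ : ℝ)).congr_fderiv ?_
    ext v
    simp
  rw [hev.lineDeriv_eq, (hd.hasLineDerivAt v).lineDeriv, neg_apply,
    innerSL_apply_apply]

lemma lineDeriv_paraboloid_of_notMem_closedBall {x z : V} {r : ℝ} (hz : z ∉ closedBall x r)
    (v : V) : lineDeriv ℝ (paraboloid x r) z v = 0 := by
  have hev : paraboloid x r =ᶠ[𝓝 z] fun _ => 0 := by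
    filter_upwards [isClosed_closedBall.isOpen_compl.mem_nhds hz] with w hw
    exact paraboloid_eq_zero fun h => hw (ball_subset_closedBall h)
  rw [hev.lineDeriv_eq]
  simp [lineDeriv]

variable [FiniteDimensional ℝ V] [MeasurableSpace V] [BorelSpace V]
  (μ : Measure V) [μ.IsAddHaarMeasure]


lemma setIntegral_ball_comp_add_smul (h : V → ℝ) (x : V) {ρ : ℝ} (hρ : 0 < ρ) :
    ∫ z in ball 0 1, h (x + ρ • z) ∂μ = (ρ ^ finrank ℝ V)⁻¹ * ∫ z in ball x ρ, h z ∂μ := by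
  rw [Measure.setIntegral_comp_smul_of_pos μ (fun z => h (x + z)) _ hρ, smul_unitBall_of_pos hρ,
    smul_eq_mul, ← (measurePreserving_add_left μ x).setIntegral_preimage_emb
      (measurableEmbedding_addLeft x) h]
  simp

/-- Integration by parts on a ball against a paraboloid vanishing on its boundary. -/
lemma setIntegral_ball_inner_mul_fderiv {f : V → ℝ} (hf : ContDiff ℝ 2 f)
    (hc : HasCompactSupport f) (x : V) {r : ℝ} (hr : 0 < r) (v : V) :
    ∫ z in ball x r, ⟪z - x, v⟫ * fderiv ℝ f z v ∂μ =
      ∫ z in ball x r, paraboloid x r z * fderiv ℝ (fderiv ℝ f) z v v ∂μ := by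
  have hdf : ContDiff ℝ 1 (fun z => fderiv ℝ f z v) :=
    (hf.fderiv_right (by norm_num)).clm_apply contDiff_const
  have hdc : HasCompactSupport (fun z => fderiv ℝ f z v) := hc.fderiv_apply ℝ v
  obtain ⟨C, hC⟩ := hdf.lipschitzWith_of_hasCompactSupport hdc one_ne_zero
  lift r to ℝ≥0 using hr.le
  have key := (lipschitzWith_paraboloid x r).integral_lineDeriv_mul_eq (μ := μ) hC hdc v
  have hleft : ∫ z, lineDeriv ℝ (paraboloid x r) z v * fderiv ℝ f z v ∂μ =
      -∫ z in ball x r, ⟪z - x, v⟫ * fderiv ℝ f z v ∂μ := by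
    rw [← integral_neg, ← integral_indicator measurableSet_ball]
    refine integral_congr_ae ?_
    filter_upwards [measure_eq_zero_iff_ae_notMem.1
      (Measure.addHaar_sphere_of_ne_zero μ x hr.ne')] with z hz
    by_cases hzb : z ∈ ball x r
    · rw [indicator_of_mem hzb, lineDeriv_paraboloid_of_mem_ball hzb]
      ring
    · rw [indicator_of_notMem hzb, lineDeriv_paraboloid_of_notMem_closedBall, zero_mul]
      intro hzc
      rw [← ball_union_sphere] at hzc
      exact hzc.elim hzb hz
  have hright : ∫ z, lineDeriv ℝ (fun z => fderiv ℝ f z v) z (-v) * paraboloid x r z ∂μ =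
      -∫ z in ball x r, paraboloid x r z * fderiv ℝ (fderiv ℝ f) z v v ∂μ := by
    rw [← integral_neg, ← integral_indicator measurableSet_ball]
    congr 1
    ext z
    by_cases hzb : z ∈ ball x r
    · rw [indicator_of_mem hzb, (hdf.differentiable (by norm_num) z).lineDeriv_eq_fderiv,
        fderiv_clm_apply ((hf.fderiv_right (m := 1) (by norm_num)).differentiable (by norm_num) z)
          (differentiableAt_const v)]
      simp
      ring
    · rw [indicator_of_notMem hzb, paraboloid_eq_zero hzb, mul_zero]
  rw [hleft, hright] at key
  exact neg_injective key

/-- The flux identity on a ball: the radial derivative integrates to a weighted integral of the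
Laplacian. -/
lemma setIntegral_ball_fderiv_sub {f : V → ℝ} (hf : ContDiff ℝ 2 f)
    (hc : HasCompactSupport f) (x : V) {r : ℝ} (hr : 0 < r) :
    ∫ z in ball x r, fderiv ℝ f z (z - x) ∂μ =
      ∫ z in ball x r, paraboloid x r z * Δ f z ∂μ := by
  have hdf : ContDiff ℝ 1 (fderiv ℝ f) := hf.fderiv_right (by norm_num)
  have hddf : Continuous (fderiv ℝ (fderiv ℝ f)) := hdf.continuous_fderiv (by norm_num)
  have hpar : Continuous (paraboloid x r) := by
    unfold paraboloid
    fun_prop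
  have hint {g : V → ℝ} (hg : Continuous g) : IntegrableOn g (ball x r) μ :=
    (hg.continuousOn.integrableOn_compact (isCompact_closedBall x r)).mono_set
      ball_subset_closedBall
  set b := stdOrthonormalBasis ℝ V
  have hleft (z : V) : fderiv ℝ f z (z - x) = ∑ i, ⟪z - x, b i⟫ * fderiv ℝ f z (b i) := by
    conv_lhs => rw [← b.sum_repr' (z - x)]
    simp [real_inner_comm]
  simp_rw [hleft, laplacian_apply_eq_sum_fderiv, Finset.mul_sum]
  rw [integral_finsetSum, integral_finsetSum]
  · exact Finset.sum_congr rfl fun i _ => setIntegral_ball_inner_mul_fderiv μ hf hc x hr (b i)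
  · exact fun i _ => hint (by fun_prop)
  · exact fun i _ => hint (by have := hdf.continuous; fun_prop)

/-- The mean over the ball of radius `ρ` is differentiable in `ρ`. -/
lemma hasDerivAt_setIntegral_ball_comp_add_smul {f : V → ℝ} (hf : ContDiff ℝ 1 f)
    (hc : HasCompactSupport f) (x : V) (ρ : ℝ) :
    HasDerivAt (fun ρ : ℝ => ∫ z in ball 0 1, f (x + ρ • z) ∂μ)
      (∫ z in ball 0 1, fderiv ℝ f (x + ρ • z) z ∂μ) ρ := by
  have hdf : Continuous (fderiv ℝ f) := hf.continuous_fderiv one_ne_zero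
  have hcf := hf.continuous
  have hint {g : V → ℝ} (hg : Continuous g) : IntegrableOn g (ball 0 1) μ :=
    (hg.continuousOn.integrableOn_compact (isCompact_closedBall 0 1)).mono_set
      ball_subset_closedBall
  obtain ⟨C, hC⟩ := (hc.fderiv ℝ).exists_bound_of_continuous hdf
  refine (hasDerivAt_integral_of_dominated_loc_of_deriv_le (bound := fun _ => C)
    (F' := fun ρ z => fderiv ℝ f (x + ρ • z) z) univ_mem ?_ ?_ ?_ ?_ ?_ ?_).2
  · exact .of_forall fun ρ => (hint (by fun_prop)).aestronglyMeasurable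
  · exact hint (by fun_prop)
  · exact (hint (by fun_prop)).aestronglyMeasurable
  · refine (ae_restrict_mem measurableSet_ball).mono fun z hz ρ _ => ?_
    refine ((fderiv ℝ f (x + ρ • z)).le_opNorm z).trans ?_
    have hz1 : ‖z‖ ≤ 1 := (mem_ball_zero_iff.1 hz).le
    calc ‖fderiv ℝ f (x + ρ • z)‖ * ‖z‖ ≤ ‖fderiv ℝ f (x + ρ • z)‖ * 1 := by gcongr
      _ ≤ C := by simpa using hC (x + ρ • z)
  · exact hint continuous_const
  · refine .of_forall fun z ρ _ => ?_
    have hline : HasDerivAt (fun ρ : ℝ => x + ρ • z) z ρ := by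
      simpa using ((hasDerivAt_id ρ).smul_const z).const_add x
    exact (hf.differentiable one_ne_zero _).hasFDerivAt.comp_hasDerivAt ρ hline

/-- The mean value property for compactly supported functions with vanishing Laplacian on the
ball. -/
lemma setIntegral_ball_eq_of_laplacian_eq_zero {f : V → ℝ} (hf : ContDiff ℝ 2 f)
    (hc : HasCompactSupport f) {x : V} {r : ℝ} (hr : 0 < r) (h0 : ∀ z ∈ ball x r, Δ f z = 0) :
    ∫ z in ball x r, f z ∂μ = μ.real (ball x r) * f x := by
  have hderiv := hasDerivAt_setIntegral_ball_comp_add_smul μ (hf.of_le one_le_two) hc x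
  obtain ⟨ρ, ⟨hρ, hρr⟩, hslope⟩ := exists_hasDerivAt_eq_slope _ _ hr
    (fun ρ _ => (hderiv ρ).continuousAt.continuousWithinAt) fun ρ _ => hderiv ρ
  have hzero : ∫ z in ball 0 1, fderiv ℝ f (x + ρ • z) z ∂μ = 0 := by
    have hscale := setIntegral_ball_comp_add_smul μ (fun z => fderiv ℝ f z (z - x)) x hρ
    have hlap : ∫ z in ball x ρ, paraboloid x ρ z * Δ f z ∂μ = 0 :=
      setIntegral_eq_zero_of_forall_eq_zero fun z hz => by
        rw [h0 z (ball_subset_ball hρr.le hz), mul_zero]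
    rw [setIntegral_ball_fderiv_sub μ hf hc x hρ, hlap, mul_zero] at hscale
    simp only [add_sub_cancel_left, map_smul, smul_eq_mul, integral_const_mul] at hscale
    exact (mul_eq_zero.1 hscale).resolve_left hρ.ne'
  rw [hzero, eq_comm, div_eq_zero_iff, sub_zero, or_iff_left hr.ne', sub_eq_zero,
    setIntegral_ball_comp_add_smul μ f x hr] at hslope
  have hpow : r ^ finrank ℝ V ≠ 0 := by positivity
  rw [inv_mul_eq_iff_eq_mul₀ hpow] at hslope
  rw [hslope, Measure.real, Measure.addHaar_ball_of_pos μ x hr, ENNReal.toReal_mul,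
    ENNReal.toReal_ofReal (by positivity)]
  simp [Measure.real, mul_assoc]

/-- The mean value property of harmonic functions over balls. -/
theorem setIntegral_ball_eq_of_harmonicOnNhd {f : V → ℝ} {x : V} {r : ℝ} (hr : 0 < r)
    (hf : HarmonicOnNhd f (closedBall x r)) :
    ∫ z in ball x r, f z ∂μ = μ.real (ball x r) * f x := by
  obtain ⟨δ, hδ, hsub⟩ := (isCompact_closedBall x r).exists_cthickening_subset_open
    (isOpen_setOfPred_harmonicAt f) hf
  rw [cthickening_closedBall hδ.le hr.le] at hsub
  let χ : ContDiffBump x := ⟨r, δ + r, hr, by linarith⟩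
  have hχ {z : V} (hz : z ∈ closedBall x r) : χ z = 1 := χ.one_of_mem_closedBall hz
  have hsmooth : ContDiff ℝ 2 (fun z => χ z * f z) := by
    rw [contDiff_iff_contDiffAt]
    intro z
    by_cases hz : z ∈ closedBall x (δ + r)
    · exact χ.contDiffAt.mul (hsub hz).1
    · have hev : (fun z => χ z * f z) =ᶠ[𝓝 z] fun _ => 0 := by
        filter_upwards [isClosed_closedBall.isOpen_compl.mem_nhds hz] with w hw
        rw [χ.zero_of_le_dist (not_le.1 fun h => hw h).le, zero_mul]
      exact contDiffAt_const.congr_of_eventuallyEq hev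
  have hcut := setIntegral_ball_eq_of_laplacian_eq_zero μ hsmooth χ.hasCompactSupport.mul_right hr
    fun z hz => by
      have hev : (fun z => χ z * f z) =ᶠ[𝓝 z] f := by
        filter_upwards [isOpen_ball.mem_nhds hz] with w hw
        rw [hχ (ball_subset_closedBall hw), one_mul]
      rw [(laplacian_congr_nhds hev).eq_of_nhds]
      exact (hf z (ball_subset_closedBall hz)).2.eq_of_nhds
  rw [hχ (mem_closedBall_self hr.le), one_mul] at hcut
  rw [← hcut]
  exact setIntegral_congr_fun measurableSet_ball fun z hz => by
    rw [hχ (ball_subset_closedBall hz), one_mul]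

end MeanValue

lemma erealToENNReal_coe (a : ℝ) : erealToENNReal (a : EReal) = ENNReal.ofReal a := by
  simp [erealToENNReal]

/-- The ball average of a nonnegative real-valued function. -/
lemma erealBallAvg_coe_of_nonneg {V : Type*} [NormedAddCommGroup V] [MeasureSpace V] {g : V → ℝ}
    (hg : ∀ z, 0 ≤ g z) (x : V) (r : ℝ) :
    erealBallAvg (fun z => (g z : EReal)) x r =
      (((∫⁻ z in ball x r, ENNReal.ofReal (g z)) / volume (ball x r) : ℝ≥0∞) : EReal) := by
  have hneg (z : V) : erealToENNReal (-(g z : EReal)) = 0 := by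
    rw [← EReal.coe_neg, erealToENNReal_coe, ENNReal.ofReal_eq_zero]
    exact neg_nonpos.2 (hg z)
  simp [erealBallAvg, hneg, erealToENNReal_coe]

/-- Away from the point `y`, the Newtonian kernel with pole `y` is at most the ball averages of any
function dominating it. -/
lemma ofReal_le_lintegral_div_of_newtonian_le {m : ℕ} {g : EuclideanSpace ℝ (Fin m) → ℝ}
    {x y : EuclideanSpace ℝ (Fin m)} {r : ℝ} (hr : 0 < r) (hrxy : r < dist x y)
    (hg : ∀ z ∈ ball x r, ‖z - y‖ ^ ((2 : ℝ) - m) ≤ g z) :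
    ENNReal.ofReal (‖x - y‖ ^ ((2 : ℝ) - m)) ≤
      (∫⁻ z in ball x r, ENNReal.ofReal (g z)) / volume (ball x r) := by
  have hharm : InnerProductSpace.HarmonicOnNhd (fun z => ‖z - y‖ ^ ((2 : ℝ) - m))
      (closedBall x r) := fun z hz => by
    have hzy : z ≠ y := by
      rintro rfl
      exact hrxy.not_ge (by rwa [dist_comm])
    simpa using harmonicAt_norm_sub_rpow hzy
  have hint : IntegrableOn (fun z => ‖z - y‖ ^ ((2 : ℝ) - m)) (ball x r) :=
    (hharm.continuousOn.integrableOn_compact (isCompact_closedBall x r)).mono_set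
      ball_subset_closedBall
  have hmean := setIntegral_ball_eq_of_harmonicOnNhd volume hr hharm
  rw [ENNReal.le_div_iff_mul_le (Or.inl (measure_ball_pos volume x hr).ne')
    (Or.inl measure_ball_lt_top.ne)]
  calc ENNReal.ofReal (‖x - y‖ ^ ((2 : ℝ) - m)) * volume (ball x r)
      = ENNReal.ofReal (∫ z in ball x r, ‖z - y‖ ^ ((2 : ℝ) - m)) := by
        rw [hmean, ENNReal.ofReal_mul measureReal_nonneg, ofReal_measureReal measure_ball_lt_top.ne,
          mul_comm]
    _ = ∫⁻ z in ball x r, ENNReal.ofReal (‖z - y‖ ^ ((2 : ℝ) - m)) :=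
        ofReal_integral_eq_lintegral_ofReal hint
          (.of_forall fun z => Real.rpow_nonneg (norm_nonneg _) _)
    _ ≤ ∫⁻ z in ball x r, ENNReal.ofReal (g z) :=
        setLIntegral_mono' measurableSet_ball fun z hz => ENNReal.ofReal_le_ofReal (hg z hz)

/-- Theorem (statement 4): for `m > 2` and any domain `Ω ⊊ ℝᵐ`, the function
`x ↦ (d_{∂Ω}(x))^{2-m}` is subharmonic on `Ω`. -/
theorem distPow_subharmonic (m : ℕ) (hm : 2 < m) (Ω : Set (EuclideanSpace ℝ (Fin m)))
    (hopen : IsOpen Ω) (hconn : IsConnected Ω) (hne : Ω ≠ Set.univ) :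
    IsSubharmonicOn
      (fun x => (((infDist x (frontier Ω)) ^ ((2 : ℝ) - m) : ℝ) : EReal)) Ω := by
  have : Nontrivial (EuclideanSpace ℝ (Fin m)) := by
    have : Nonempty (Fin m) := ⟨⟨0, by omega⟩⟩
    infer_instance
  have hfr : (frontier Ω).Nonempty := nonempty_frontier_iff.2 ⟨hconn.nonempty, hne⟩
  have hpos : ∀ x ∈ Ω, 0 < infDist x (frontier Ω) := fun x hx =>
    (isClosed_frontier.notMem_iff_infDist_pos hfr).1
      (disjoint_left.1 (disjoint_frontier_iff_isOpen.2 hopen).symm hx)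
  refine ⟨?_, ?_, fun x _ => EReal.coe_lt_top _, ?_⟩
  · refine ContinuousOn.upperSemicontinuousOn ?_
    exact continuous_coe_real_ereal.comp_continuousOn
      ((continuous_infDist_pt _).continuousOn.rpow_const fun x hx => Or.inl (hpos x hx).ne')
  · intro h
    obtain ⟨x, hx⟩ := hconn.nonempty
    exact EReal.coe_ne_bot _ (h x hx)
  · intro x hx
    obtain ⟨y, hy, hxy⟩ := isClosed_frontier.exists_infDist_eq_dist hfr x
    refine ⟨infDist x (frontier Ω), hpos x hx, fun r hr hrR hsub => ?_⟩
    have hm' : (2 : ℝ) - m ≤ 0 := by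
      have : (2 : ℝ) < m := by exact_mod_cast hm
      linarith
    have hle := EReal.coe_ennreal_le_coe_ennreal_iff.2 <|
      ofReal_le_lintegral_div_of_newtonian_le (g := fun z => infDist z (frontier Ω) ^ ((2 : ℝ) - m))
        hr (hxy ▸ hrR) fun z hz => by
          refine Real.rpow_le_rpow_of_nonpos (hpos z (hsub (ball_subset_closedBall hz))) ?_ hm'
          rw [← dist_eq_norm]
          exact infDist_le_dist_of_mem hy
    rw [erealBallAvg_coe_of_nonneg fun z => Real.rpow_nonneg infDist_nonneg _]
    rw [← dist_eq_norm, ← hxy, EReal.coe_ennreal_ofReal,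
      max_eq_left (Real.rpow_nonneg infDist_nonneg _)] at hle
    exact hle

end
end
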